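/- Let X₁,…,X_m be infinite dimensional Banach spaces with normalized unconditional Schauder bases (x_n^{(k)}), k = 1,…,m, let q > 0, and let Y be a Banach space. Suppose every continuous m-linear mapping from X₁ × ⋯ × X_m into Y is absolutely (q;1)-summing. If either (i) q < 1, Y is nonzero and finite dimensional, or (ii) Y is infinite dimensional and there exists s ≥ 2 with s > q such that Y does not have cotype s, then for every t > q and all x_k = ∑_j a_j^{(k)} x_j^{(k)} ∈ X_k (k = 1,…,m) one has ∑_j (∏_{k=1}^m |a_j^{(k)}|)^t < ∞. -/

import Mathlib

open scoped BigOperators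

/-- A sequence in a normed space is *weakly 1-summable*. -/
def WeaklySummable (𝕂 : Type*) [RCLike 𝕂] {X : Type*} [NormedAddCommGroup X]
    [NormedSpace 𝕂 X] (x : ℕ → X) : Prop :=
  ∀ φ : X →L[𝕂] 𝕂, Summable fun j => ‖φ (x j)‖

/-- A normed space has cotype `q` (Rademacher averages written as an average over signs). -/
def HasCotype (X : Type*) [NormedAddCommGroup X] (q : ℝ) : Prop :=
  ∃ C : ℝ, 0 ≤ C ∧ ∀ (k : ℕ) (x : Fin k → X),
    (∑ j, ‖x j‖ ^ q) ^ (1 / q) ≤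
      C * Real.sqrt ((2 ^ k : ℝ)⁻¹ *
        ∑ ε : Fin k → Bool, ‖∑ j, (if ε j then x j else -x j)‖ ^ 2)

/-- `e` is a normalized unconditional Schauder basis of `X`. -/
def IsNormalizedUncondBasis (𝕂 : Type*) [RCLike 𝕂] (X : Type*) [NormedAddCommGroup X]
    [NormedSpace 𝕂 X] (e : ℕ → X) : Prop :=
  (∀ n, ‖e n‖ = 1) ∧
  (∀ x : X, ∃! a : ℕ → 𝕂, HasSum (fun n => a n • e n) x) ∧
  ∃ ρ : ℝ, 1 ≤ ρ ∧ ∀ (a ε : ℕ → 𝕂) (x y : X),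
    (∀ n, ε n = 1 ∨ ε n = -1) →
    HasSum (fun n => a n • e n) x → HasSum (fun n => (ε n * a n) • e n) y →
    ‖y‖ ≤ ρ * ‖x‖

lemma expect_comp_surjective_hom {G H : Type*} [Group G] [Fintype G] [Group H] [Fintype H]
    (π : G →* H) (hπ : Function.Surjective π) (f : H → ℝ) : 𝔼 g, f (π g) = 𝔼 h, f h := by
  choose s hs using hπ
  calc 𝔼 g, f (π g) = 𝔼 _h : H, 𝔼 g, f (π g) := (Fintype.expect_const _).symm
    _ = 𝔼 h, 𝔼 g, f (π g * h) := by
        refine Finset.expect_congr rfl fun h _ => ?_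
        refine (Fintype.expect_equiv (Equiv.mulRight (s h)) _ _ fun g => ?_).symm
        simp [hs]
    _ = 𝔼 g, 𝔼 h, f (π g * h) := Finset.expect_comm _ _ _
    _ = 𝔼 _g : G, 𝔼 h, f h := by
        refine Finset.expect_congr rfl fun g _ => ?_
        exact Fintype.expect_equiv (Equiv.mulLeft (π g)) _ _ fun h => rfl
    _ = 𝔼 h, f h := Fintype.expect_const _

lemma expect_mul_right {G : Type*} [Group G] [Fintype G] (η : G) (f : G → ℝ) :
    𝔼 g, f (g * η) = 𝔼 g, f g :=
  Fintype.expect_equiv (Equiv.mulRight η) _ _ fun _ => rfl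

lemma signs_comp_surjective {ι κ : Type*} (e : κ → ι) (he : Function.Injective e) :
    Function.Surjective (fun ε : ι → ℤˣ => ε ∘ e) := fun δ =>
  ⟨Function.extend e δ 1, funext fun j => by simp [he.extend_apply]⟩

lemma expect_signs_comp {ι κ : Type*} [Fintype ι] [Fintype κ] [DecidableEq ι] [DecidableEq κ]
    (e : κ → ι) (he : Function.Injective e) (f : (κ → ℤˣ) → ℝ) :
    𝔼 ε : ι → ℤˣ, f (ε ∘ e) = 𝔼 δ, f δ :=
  expect_comp_surjective_hom
    ({ toFun := fun ε => ε ∘ e, map_one' := rfl, map_mul' := fun _ _ => rfl } :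
      (ι → ℤˣ) →* (κ → ℤˣ)) (signs_comp_surjective e he) f

section Rademacher

variable {Y : Type*} [NormedAddCommGroup Y]

/-- The second moment of the Rademacher sum of a finite family. -/
noncomputable def rademacher {ι : Type*} [Fintype ι] [DecidableEq ι] (x : ι → Y) : ℝ :=
  𝔼 ε : ι → ℤˣ, ‖∑ j, ε j • x j‖ ^ 2

variable {ι κ P J : Type*} [Fintype ι] [DecidableEq ι] [Fintype κ] [DecidableEq κ]
  [Fintype P] [DecidableEq P] [Fintype J] [DecidableEq J]

lemma rademacher_nonneg (x : ι → Y) : 0 ≤ rademacher x :=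
  Finset.expect_nonneg fun _ _ => by positivity

lemma sum_rademacher_blocks_le {D : ℝ}
    (hD : ∀ y : P → Y, ∑ p, ‖y p‖ ^ 2 ≤ D * rademacher y) (x : P × J → Y) :
    ∑ p, rademacher (fun j => x (p, j)) ≤ D * rademacher x := by
  set S : (P × J → ℤˣ) → P → Y := fun ε p => ∑ j, ε (p, j) • x (p, j)
  have h1 : ∀ p, rademacher (fun j => x (p, j)) = 𝔼 ε, ‖S ε p‖ ^ 2 := fun p =>
    (expect_signs_comp (fun j => (p, j)) (Prod.mk_right_injective p)
      fun δ => ‖∑ j, δ j • x (p, j)‖ ^ 2).symm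
  have h2 : rademacher x = 𝔼 ε, rademacher (S ε) := by
    unfold rademacher
    rw [Finset.expect_comm]
    have : ∀ δ : P → ℤˣ, 𝔼 ε, ‖∑ p, δ p • S ε p‖ ^ 2 = 𝔼 ε : P × J → ℤˣ, ‖∑ j, ε j • x j‖ ^ 2 := by
      intro δ
      rw [← expect_mul_right (fun i : P × J => δ i.1) fun ε => ‖∑ j, ε j • x j‖ ^ 2]
      refine Finset.expect_congr rfl fun ε _ => ?_
      congr 2
      rw [Fintype.sum_prod_type]
      simp [S, Finset.smul_sum, smul_smul, mul_comm]
    simp only [this]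
    exact (Fintype.expect_const _).symm
  rw [h2, Finset.mul_expect]
  simp only [h1]
  rw [← Finset.expect_sum_comm]
  exact Finset.expect_le_expect fun ε _ => hD _

lemma expect_le_sqrt (x : ι → Y) :
    𝔼 ε : ι → ℤˣ, ‖∑ j, ε j • x j‖ ≤ √(rademacher x) := by
  apply Real.le_sqrt_of_sq_le
  unfold rademacher
  simp only [Fintype.expect_eq_sum_div_card]
  rw [div_pow, div_le_div_iff₀ (by positivity) (by positivity)]
  have := sq_sum_le_card_mul_sum_sq (s := Finset.univ) (f := fun ε : ι → ℤˣ => ‖∑ j, ε j • x j‖)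
  rw [Finset.card_univ] at this
  nlinarith [(Nat.cast_nonneg (Fintype.card (ι → ℤˣ)) : (0:ℝ) ≤ _)]

variable [NormedSpace ℝ Y]

lemma rademacher_comp_le (x : ι → Y) (e : κ → ι) (he : Function.Injective e) :
    rademacher (x ∘ e) ≤ rademacher x := by
  classical
  set η : ι → ℤˣ := fun i => if i ∈ Set.range e then 1 else -1
  have h1 : rademacher (x ∘ e) = 𝔼 ε : ι → ℤˣ, ‖∑ j, ε (e j) • x (e j)‖ ^ 2 :=
    (expect_signs_comp e he fun δ => ‖∑ j, δ j • x (e j)‖ ^ 2).symm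
  have h2 : rademacher x = 𝔼 ε : ι → ℤˣ,
      (‖∑ j, ε j • x j‖ ^ 2 + ‖∑ j, (ε * η) j • x j‖ ^ 2) / 2 := by
    rw [← Finset.expect_div, Finset.expect_add_distrib,
      expect_mul_right η fun ε : ι → ℤˣ => ‖∑ j, ε j • x j‖ ^ 2]
    simp [rademacher]
  rw [h1, h2]
  refine Finset.expect_le_expect fun ε _ => ?_
  have h3 : (2 : ℤ) • ∑ j, ε (e j) • x (e j)
      = ∑ j, ε j • x j + ∑ j, (ε * η) j • x j := by
    rw [← Finset.sum_add_distrib, Finset.smul_sum,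
      ← Finset.sum_image (g := e) (f := fun i => (2 : ℤ) • ε i • x i) (fun a _ b _ h => he h)]
    rw [← Finset.sum_subset (Finset.subset_univ _)]
    · refine Finset.sum_congr rfl fun i hi => ?_
      have : η i = 1 := by simp only [η]; rw [if_pos]; simpa using hi
      simp [this, two_smul]
    · intro i _ hi
      have : η i = -1 := by simp only [η]; rw [if_neg]; simpa using hi
      simp [this]
  have h4 : 2 * ‖∑ j, ε (e j) • x (e j)‖ ≤ ‖∑ j, ε j • x j‖ + ‖∑ j, (ε * η) j • x j‖ := by
    have : ‖(2 : ℤ) • ∑ j, ε (e j) • x (e j)‖ = 2 * ‖∑ j, ε (e j) • x (e j)‖ := by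
      rw [two_smul, ← two_smul ℝ, norm_smul, Real.norm_ofNat]
    rw [← this, h3]
    exact norm_add_le _ _
  nlinarith [norm_nonneg (∑ j, ε (e j) • x (e j)), sq_nonneg (‖∑ j, ε j • x j‖ - ‖∑ j, (ε * η) j • x j‖)]

lemma norm_le_sqrt_rademacher (x : ι → Y) (i : ι) : ‖x i‖ ≤ √(rademacher x) := by
  apply Real.le_sqrt_of_sq_le
  have := rademacher_comp_le x (fun _ : Unit => i) (fun _ _ _ => rfl)
  refine le_trans (le_of_eq ?_) this
  simp [rademacher, norm_units_zsmul]

lemma expect_sq_sum_signs (a : ι → ℝ) :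
    𝔼 ε : ι → ℤˣ, (∑ j, (ε j : ℝ) * a j) ^ 2 = ∑ j, a j ^ 2 := by
  have h : ∀ i j, 𝔼 ε : ι → ℤˣ, ((ε i : ℝ) * a i) * ((ε j : ℝ) * a j)
      = if i = j then a i ^ 2 else 0 := by
    intro i j
    split_ifs with hij
    · subst hij
      rw [← Fintype.expect_const (ι := ι → ℤˣ) (a i ^ 2)]
      refine Finset.expect_congr rfl fun ε _ => ?_
      rcases Int.units_eq_one_or (ε i) with h | h <;> simp [h] <;> ring
    · have := expect_mul_right (Pi.mulSingle i (-1))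
        fun ε : ι → ℤˣ => ((ε i : ℝ) * a i) * ((ε j : ℝ) * a j)
      simp only [Pi.mul_apply, Pi.mulSingle_eq_same, Pi.mulSingle_eq_of_ne (Ne.symm hij)] at this
      simp only [mul_neg, mul_one, Units.val_neg, Int.cast_neg, neg_mul,
        Finset.expect_neg_distrib] at this
      linarith
  calc _ = 𝔼 ε : ι → ℤˣ, ∑ i, ∑ j, ((ε i : ℝ) * a i) * ((ε j : ℝ) * a j) :=
        Finset.expect_congr rfl fun ε _ => by rw [sq, Finset.sum_mul_sum]
    _ = _ := by
        simp only [Finset.expect_sum_comm, h]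
        simp

lemma units_smul_eq (e : ℤˣ) (y : Y) : e • y = ((e : ℤ) : ℝ) • y := by
  rcases Int.units_eq_one_or e with h | h <;> simp [h]

lemma sum_sq_le_rademacher (x : ι → Y) (φ : StrongDual ℝ Y) (hφ : ‖φ‖ ≤ 1) :
    ∑ j, φ (x j) ^ 2 ≤ rademacher x := by
  rw [← expect_sq_sum_signs]
  refine Finset.expect_le_expect fun ε _ => ?_
  have : ∑ j, (ε j : ℝ) * φ (x j) = φ (∑ j, ε j • x j) := by
    simp [units_smul_eq]
  rw [this, ← sq_abs]
  gcongr
  exact (φ.le_of_opNorm_le hφ _).trans (by simp)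

end Rademacher

section Contraction

variable {T : Type*} {ι : Type*} [Fintype ι]

lemma ciSup_add_ciSup_sub_le [Nonempty T] {h a b : T → ℝ}
    (hab : ∀ t s, |b t - b s| ≤ |a t - a s|)
    (h1 : BddAbove (Set.range fun t => h t + a t)) (h2 : BddAbove (Set.range fun t => h t - a t)) :
    (⨆ t, (h t + b t)) + (⨆ t, (h t - b t)) ≤ (⨆ t, (h t + a t)) + ⨆ t, (h t - a t) := by
  rw [← le_sub_iff_add_le]
  refine ciSup_le fun t => ?_
  rw [le_sub_comm]
  refine ciSup_le fun s => ?_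
  have ht1 : h t + a t ≤ _ := le_ciSup h1 t
  have ht2 : h t - a t ≤ _ := le_ciSup h2 t
  have hs1 : h s + a s ≤ _ := le_ciSup h1 s
  have hs2 : h s - a s ≤ _ := le_ciSup h2 s
  have := (le_abs_self _).trans (hab t s)
  rcases abs_cases (a t - a s) with h | h <;> linarith

lemma bddAbove_range_sum_signs {c : ι → T → ℝ} {B : ℝ} (hB : ∀ j t, |c j t| ≤ B) (ε : ι → ℤˣ) :
    BddAbove (Set.range fun t => ∑ j, (ε j : ℝ) * c j t) := by
  refine ⟨∑ _j : ι, B, ?_⟩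
  rintro _ ⟨t, rfl⟩
  refine Finset.sum_le_sum fun j _ => ?_
  have := hB j t
  rcases Int.units_eq_one_or (ε j) with h | h <;> simp [h]
  · exact (le_abs_self _).trans this
  · exact (neg_le_abs _).trans this

variable [DecidableEq ι]

lemma expect_ciSup_update_le [Nonempty T] {c : ι → T → ℝ} {B : ℝ} (hB : ∀ j t, |c j t| ≤ B)
    (i : ι) {b : T → ℝ} (hb : ∀ t s, |b t - b s| ≤ |c i t - c i s|) :
    𝔼 ε : ι → ℤˣ, (⨆ t, ∑ j, (ε j : ℝ) * Function.update c i b j t)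
      ≤ 𝔼 ε : ι → ℤˣ, ⨆ t, ∑ j, (ε j : ℝ) * c j t := by
  have key : ∀ d : ι → T → ℝ, 𝔼 ε : ι → ℤˣ, (⨆ t, ∑ j, (ε j : ℝ) * d j t)
      = 𝔼 ε : ι → ℤˣ, ((⨆ t, (∑ j ∈ Finset.univ.erase i, (ε j : ℝ) * d j t + (ε i : ℝ) * d i t))
        + ⨆ t, (∑ j ∈ Finset.univ.erase i, (ε j : ℝ) * d j t - (ε i : ℝ) * d i t)) / 2 := by
    intro d
    have h1 : ∀ ε : ι → ℤˣ, ∀ t, ∑ j, (ε j : ℝ) * d j t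
        = ∑ j ∈ Finset.univ.erase i, (ε j : ℝ) * d j t + (ε i : ℝ) * d i t := fun ε t =>
      (Finset.sum_erase_add _ _ (Finset.mem_univ i)).symm
    have h2 : ∀ ε : ι → ℤˣ, ∀ t, ∑ j, ((ε * (Pi.mulSingle i (-1) : ι → ℤˣ)) j : ℝ) * d j t
        = ∑ j ∈ Finset.univ.erase i, (ε j : ℝ) * d j t - (ε i : ℝ) * d i t := fun ε t => by
      rw [← Finset.sum_erase_add _ _ (Finset.mem_univ i)]
      simp only [Pi.mul_apply, Pi.mulSingle_eq_same, mul_neg, mul_one, Units.val_neg,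
        Int.cast_neg, neg_mul, ← sub_eq_add_neg]
      congr 1
      refine Finset.sum_congr rfl fun j hj => ?_
      simp [Pi.mulSingle_eq_of_ne (Finset.ne_of_mem_erase hj)]
    simp only [← h1, ← h2]
    rw [← Finset.expect_div, Finset.expect_add_distrib,
      expect_mul_right (Pi.mulSingle i (-1)) fun ε : ι → ℤˣ => ⨆ t, ∑ j, (ε j : ℝ) * d j t]
    ring
  rw [key, key]
  refine Finset.expect_le_expect fun ε _ => ?_
  gcongr ?_ / 2
  have h3 : ∀ t, ∑ j ∈ Finset.univ.erase i, (ε j : ℝ) * Function.update c i b j t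
      = ∑ j ∈ Finset.univ.erase i, (ε j : ℝ) * c j t := fun t =>
    Finset.sum_congr rfl fun j hj => by
      rw [Function.update_of_ne (Finset.ne_of_mem_erase hj)]
  simp only [h3, Function.update_self]
  have bdd := bddAbove_range_sum_signs hB ε
  have bdd' := bddAbove_range_sum_signs hB (ε * Pi.mulSingle i (-1))
  refine ciSup_add_ciSup_sub_le (fun t s => ?_) ?_ ?_
  · rw [← mul_sub, ← mul_sub, abs_mul, abs_mul]
    exact mul_le_mul_of_nonneg_left (hb t s) (abs_nonneg _)
  · convert bdd using 3 with t
    exact Finset.sum_erase_add _ _ (Finset.mem_univ i)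
  · convert bdd' using 3 with t
    rw [← Finset.sum_erase_add _ _ (Finset.mem_univ i)]
    simp only [Pi.mul_apply, Pi.mulSingle_eq_same, mul_neg, mul_one, Units.val_neg,
      Int.cast_neg, neg_mul, ← sub_eq_add_neg]
    congr 1
    refine Finset.sum_congr rfl fun j hj => ?_
    simp [Pi.mulSingle_eq_of_ne (Finset.ne_of_mem_erase hj)]

/-- Contraction principle for absolute values. -/
lemma expect_ciSup_abs_le [Nonempty T] {c : ι → T → ℝ} {B : ℝ} (hB : ∀ j t, |c j t| ≤ B) :
    𝔼 ε : ι → ℤˣ, (⨆ t, ∑ j, (ε j : ℝ) * |c j t|)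
      ≤ 𝔼 ε : ι → ℤˣ, ⨆ t, ∑ j, (ε j : ℝ) * c j t := by
  suffices h : ∀ s : Finset ι,
      𝔼 ε : ι → ℤˣ, (⨆ t, ∑ j, (ε j : ℝ) * (if j ∈ s then |c j t| else c j t))
      ≤ 𝔼 ε : ι → ℤˣ, ⨆ t, ∑ j, (ε j : ℝ) * c j t by
    simpa using h Finset.univ
  intro s
  induction s using Finset.induction_on with
  | empty => simp
  | insert i s hi ih =>
    refine le_trans ?_ ih
    have := expect_ciSup_update_le (c := fun j t => if j ∈ s then |c j t| else c j t) (B := B)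
      (fun j t => by split_ifs <;> simp [hB]) i (b := fun t => |c i t|)
      (fun t s' => by simpa [hi] using abs_abs_sub_abs_le_abs_sub (c i t) (c i s'))
    refine le_of_eq_of_le ?_ this
    refine Finset.expect_congr rfl fun ε _ => ?_
    congr 1
    ext t
    refine Finset.sum_congr rfl fun j _ => ?_
    by_cases hj : j = i
    · subst hj; simp
    · simp [hj]

end Contraction

section WeakNorm

variable {Y : Type*} [NormedAddCommGroup Y] [NormedSpace ℝ Y] {ι κ J : Type*}

/-- The closed unit ball of the dual. -/
abbrev DualBall (Y : Type*) [NormedAddCommGroup Y] [NormedSpace ℝ Y] : Type _ :=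
  {φ : StrongDual ℝ Y // ‖φ‖ ≤ 1}

instance : Nonempty (DualBall Y) := ⟨⟨0, by simp⟩⟩

lemma DualBall.abs_apply_le (φ : DualBall Y) (y : Y) : |φ.1 y| ≤ ‖y‖ := by
  simpa using φ.1.le_of_opNorm_le φ.2 y

/-- The weak `ℓ₁` norm of a finite family. -/
noncomputable def weakNorm (S : Finset ι) (x : ι → Y) : ℝ :=
  ⨆ φ : DualBall Y, ∑ j ∈ S, |φ.1 (x j)|

lemma sum_abs_le_weakNorm (S : Finset ι) (x : ι → Y) (φ : DualBall Y) :
    ∑ j ∈ S, |φ.1 (x j)| ≤ weakNorm S x := by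
  refine le_ciSup (f := fun φ : DualBall Y => ∑ j ∈ S, |φ.1 (x j)|) ⟨∑ j ∈ S, ‖x j‖, ?_⟩ φ
  rintro _ ⟨ψ, rfl⟩
  exact Finset.sum_le_sum fun j _ => ψ.abs_apply_le _

lemma weakNorm_le {S : Finset ι} {x : ι → Y} {B : ℝ}
    (h : ∀ φ : DualBall Y, ∑ j ∈ S, |φ.1 (x j)| ≤ B) : weakNorm S x ≤ B := ciSup_le h

lemma weakNorm_nonneg (S : Finset ι) (x : ι → Y) : 0 ≤ weakNorm S x :=
  (Finset.sum_nonneg fun _ _ => abs_nonneg _).trans (sum_abs_le_weakNorm S x ⟨0, by simp⟩)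

lemma exists_dualBall_eq_norm (y : Y) : ∃ φ : DualBall Y, φ.1 y = ‖y‖ := by
  obtain ⟨g, hg, hy⟩ := exists_dual_vector'' ℝ y
  exact ⟨⟨g, hg⟩, by simpa using hy⟩

lemma norm_sum_smul_le {S : Finset ι} {x : ι → Y} {c : ι → ℝ} {u : ℝ} (hc : ∀ j ∈ S, |c j| ≤ u)
    (hu : 0 ≤ u) : ‖∑ j ∈ S, c j • x j‖ ≤ u * weakNorm S x := by
  obtain ⟨φ, hφ⟩ := exists_dualBall_eq_norm (∑ j ∈ S, c j • x j)
  rw [← hφ, map_sum]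
  calc ∑ j ∈ S, φ.1 (c j • x j) ≤ ∑ j ∈ S, u * |φ.1 (x j)| := by
        refine Finset.sum_le_sum fun j hj => ?_
        rw [map_smul, smul_eq_mul]
        refine (le_abs_self _).trans ?_
        rw [abs_mul]
        exact mul_le_mul_of_nonneg_right (hc j hj) (abs_nonneg _)
    _ = u * ∑ j ∈ S, |φ.1 (x j)| := (Finset.mul_sum _ _ _).symm
    _ ≤ _ := mul_le_mul_of_nonneg_left (sum_abs_le_weakNorm S x φ) hu

lemma norm_le_weakNorm {S : Finset ι} (x : ι → Y) {i : ι} (hi : i ∈ S) :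
    ‖x i‖ ≤ weakNorm S x := by
  obtain ⟨φ, hφ⟩ := exists_dualBall_eq_norm (x i)
  rw [← hφ]
  exact (le_abs_self _).trans ((Finset.single_le_sum (f := fun j => |φ.1 (x j)|)
    (fun _ _ => abs_nonneg _) hi).trans (sum_abs_le_weakNorm S x φ))

lemma exists_signs_lt_norm {S : Finset ι} {x : ι → Y} {B : ℝ} (hB : B < weakNorm S x) :
    ∃ δ : ι → ℤˣ, B < ‖∑ j ∈ S, δ j • x j‖ := by
  by_contra! h
  refine hB.not_ge (weakNorm_le fun φ => ?_)
  classical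
  set δ : ι → ℤˣ := fun j => if 0 ≤ φ.1 (x j) then 1 else -1
  refine le_trans (le_of_eq ?_) (((le_abs_self _).trans (φ.abs_apply_le _)).trans (h δ))
  rw [map_sum]
  refine Finset.sum_congr rfl fun j _ => ?_
  by_cases hj : 0 ≤ φ.1 (x j)
  · simp [δ, hj, abs_of_nonneg hj]
  · simp [δ, hj, abs_of_neg (not_le.1 hj)]

lemma weakNorm_smul (S : Finset ι) (x : ι → Y) {c : ℝ} (hc : 0 ≤ c) :
    weakNorm S (fun j => c • x j) = c * weakNorm S x := by
  unfold weakNorm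
  rw [Real.mul_iSup_of_nonneg hc]
  simp [abs_mul, abs_of_nonneg hc, Finset.mul_sum]

lemma weakNorm_map {S : Finset κ} (x : ι → Y) (e : κ ↪ ι) :
    weakNorm (S.map e) x = weakNorm S (x ∘ e) := by
  simp [weakNorm]

lemma weakNorm_blocks_le (S : Finset ι) (x : ι → Y) (𝒜 : Finset (Finset ι))
    (hd : (𝒜 : Set (Finset ι)).PairwiseDisjoint id) (hS : ∀ A ∈ 𝒜, A ⊆ S)
    (δ : Finset ι → ι → ℤˣ) :
    weakNorm 𝒜 (fun A => ∑ j ∈ A, δ A j • x j) ≤ weakNorm S x := by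
  classical
  refine weakNorm_le fun φ => ?_
  calc ∑ A ∈ 𝒜, |φ.1 (∑ j ∈ A, δ A j • x j)| ≤ ∑ A ∈ 𝒜, ∑ j ∈ A, |φ.1 (x j)| := by
        refine Finset.sum_le_sum fun A _ => ?_
        rw [map_sum]
        refine (Finset.abs_sum_le_sum_abs _ _).trans (Finset.sum_le_sum fun j _ => ?_)
        rcases Int.units_eq_one_or (δ A j) with h | h <;> simp [h]
    _ = ∑ j ∈ 𝒜.biUnion id, |φ.1 (x j)| := (Finset.sum_biUnion hd).symm
    _ ≤ ∑ j ∈ S, |φ.1 (x j)| := by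
        refine Finset.sum_le_sum_of_subset_of_nonneg ?_ fun _ _ _ => abs_nonneg _
        exact Finset.biUnion_subset.2 hS
    _ ≤ _ := sum_abs_le_weakNorm S x φ

variable [Fintype ι] [DecidableEq ι] [Fintype J] [DecidableEq J]

lemma weakNorm_univ_le_sqrt_rademacher (x : ι → Y) :
    weakNorm Finset.univ x ≤ √(Fintype.card ι) * √(rademacher x) := by
  refine weakNorm_le fun φ => ?_
  rw [← Real.sqrt_mul (by positivity)]
  apply Real.le_sqrt_of_sq_le
  refine (sq_sum_le_card_mul_sum_sq).trans ?_
  simp only [sq_abs, Finset.card_univ]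
  gcongr
  exact sum_sq_le_rademacher x φ.1 φ.2

lemma expect_ciSup_signs_abs_le (x : ι → Y) :
    𝔼 ε : ι → ℤˣ, (⨆ φ : DualBall Y, ∑ j, (ε j : ℝ) * |φ.1 (x j)|) ≤ √(rademacher x) := by
  refine le_trans (expect_ciSup_abs_le (c := fun j (φ : DualBall Y) => φ.1 (x j))
    (B := ∑ j, ‖x j‖) fun j φ => ?_) (le_trans (Finset.expect_le_expect fun ε _ => ?_)
      (expect_le_sqrt x))
  · exact (φ.abs_apply_le _).trans
      (Finset.single_le_sum (f := fun j => ‖x j‖) (fun _ _ => norm_nonneg _) (Finset.mem_univ j))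
  · refine ciSup_le fun φ => ?_
    refine le_trans (le_of_eq ?_) ((le_abs_self _).trans (φ.abs_apply_le _))
    simp [units_smul_eq]

lemma exists_signs_abs_sum_sub_le (x y : J → Y) :
    ∃ ε : J → ℤˣ, ∀ φ : DualBall Y, |∑ j, (ε j : ℝ) * (|φ.1 (x j)| - |φ.1 (y j)|)|
      ≤ 2 * √(rademacher x) + 2 * √(rademacher y) := by
  set A : (J → Y) → (J → ℤˣ) → ℝ := fun z ε => ⨆ φ : DualBall Y, ∑ j, (ε j : ℝ) * |φ.1 (z j)|
  have hA : ∀ z ε (φ : DualBall Y), ∑ j, (ε j : ℝ) * |φ.1 (z j)| ≤ A z ε := fun z ε φ =>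
    le_ciSup (bddAbove_range_sum_signs (c := fun j (φ : DualBall Y) => |φ.1 (z j)|)
      (B := ∑ j, ‖z j‖) (fun j φ => by
        rw [abs_abs]
        exact (φ.abs_apply_le _).trans (Finset.single_le_sum (f := fun j => ‖z j‖)
          (fun _ _ => norm_nonneg _) (Finset.mem_univ j))) ε) φ
  have hA0 : ∀ z ε, 0 ≤ A z ε := fun z ε => by simpa using hA z ε ⟨0, by simp⟩
  have hE : ∀ z, 𝔼 ε, (A z ε + A z (ε * -1)) ≤ 2 * √(rademacher z) := fun z => by
    rw [Finset.expect_add_distrib, expect_mul_right (-1) (A z)]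
    linarith [expect_ciSup_signs_abs_le z]
  obtain ⟨ε, -, hε⟩ := Finset.exists_le_of_expect_le
    (a := 2 * √(rademacher x) + 2 * √(rademacher y))
    (f := fun ε => (A x ε + A x (ε * -1)) + (A y ε + A y (ε * -1))) Finset.univ_nonempty
    (by rw [Finset.expect_add_distrib]; exact add_le_add (hE x) (hE y))
  simp only [mul_neg_one] at hε
  refine ⟨ε, fun φ => (abs_le'.2 ⟨?_, ?_⟩).trans hε⟩
  · have h1 := hA x ε φ
    have h2 := hA y (-ε) φ
    simp only [Pi.neg_apply, Units.val_neg, Int.cast_neg, neg_mul, Finset.sum_neg_distrib] at h2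
    simp only [mul_sub, Finset.sum_sub_distrib]
    linarith [hA0 x (-ε), hA0 y ε]
  · have h1 := hA y ε φ
    have h2 := hA x (-ε) φ
    simp only [Pi.neg_apply, Units.val_neg, Int.cast_neg, neg_mul, Finset.sum_neg_distrib] at h2
    simp only [mul_sub, Finset.sum_sub_distrib]
    linarith [hA0 y (-ε), hA0 x ε]

lemma exists_halving (x : ℤˣ × J → Y) :
    ∃ ε : J → ℤˣ, ∀ b : ℤˣ, weakNorm Finset.univ (fun j => x (b * ε j, j))
      ≤ weakNorm Finset.univ x / 2 + 2 * √(rademacher x) := by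
  obtain ⟨ε, hε⟩ := exists_signs_abs_sum_sub_le (fun j => x (1, j)) (fun j => x (-1, j))
  refine ⟨ε, fun b => weakNorm_le fun φ => ?_⟩
  have hr : ∀ b : ℤˣ, √(rademacher fun j => x (b, j)) ≤ √(rademacher x) := fun b =>
    Real.sqrt_le_sqrt (rademacher_comp_le x (fun j => (b, j)) (Prod.mk_right_injective b))
  have h1 := sum_abs_le_weakNorm Finset.univ x φ
  have huniv : (Finset.univ : Finset ℤˣ) = {1, -1} := rfl
  rw [Fintype.sum_prod_type, huniv, Finset.sum_pair (by decide)] at h1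
  have h2 : ∑ j, |φ.1 (x (b * ε j, j))| = (∑ j, |φ.1 (x (1, j))| + ∑ j, |φ.1 (x (-1, j))|) / 2
      + (b : ℝ) * (∑ j, (ε j : ℝ) * (|φ.1 (x (1, j))| - |φ.1 (x (-1, j))|)) / 2 := by
    rw [← Finset.sum_add_distrib, Finset.mul_sum, ← add_div, ← Finset.sum_add_distrib,
      Finset.sum_div]
    refine Finset.sum_congr rfl fun j _ => ?_
    rcases Int.units_eq_one_or b with h | h <;> rcases Int.units_eq_one_or (ε j) with h' | h' <;>
      simp [h, h'] <;> ring
  have h3 : (b : ℝ) * (∑ j, (ε j : ℝ) * (|φ.1 (x (1, j))| - |φ.1 (x (-1, j))|))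
      ≤ |∑ j, (ε j : ℝ) * (|φ.1 (x (1, j))| - |φ.1 (x (-1, j))|)| := by
    rcases Int.units_eq_one_or b with h | h
    · simpa [h] using le_abs_self _
    · simpa [h] using neg_le_abs _
  rw [h2]
  linarith [hε φ, hr 1, hr (-1)]

end WeakNorm

lemma dyadic_peel_aux {ι : Type*} {f : ι → ℝ} {g : Finset ι → ℝ} {u B : ℕ → ℝ} {G₀ : ℝ}
    {S₀ : Finset ι} (hg : ∀ S : Finset ι, ∀ v, g S ≤ g {j ∈ S | v < f j} + g {j ∈ S | ¬ v < f j})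
    (h0 : ∀ S ⊆ S₀, S.card ≤ 1 → g S ≤ G₀)
    (hu : ∀ i, (Finset.card {j ∈ S₀ | u i < f j}) ≤ 2 ^ i)
    (hB : ∀ i, ∀ S ⊆ S₀, S.card ≤ 2 ^ (i + 1) → (∀ j ∈ S, f j ≤ u i) → g S ≤ B i) (k : ℕ) :
    ∀ S ⊆ S₀, S.card ≤ 2 ^ k → g S ≤ G₀ + ∑ i ∈ Finset.range k, B i := by
  induction k with
  | zero => intro S hS hc; simpa using h0 S hS (by simpa using hc)
  | succ k ih =>
    intro S hS hc
    rw [Finset.sum_range_succ, ← add_assoc]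
    refine (hg S (u k)).trans (add_le_add (ih _ ((Finset.filter_subset _ _).trans hS) ?_)
      (hB k _ ((Finset.filter_subset _ _).trans hS) ((Finset.card_filter_le _ _).trans hc) ?_))
    · exact (Finset.card_le_card (Finset.filter_subset_filter _ hS)).trans (hu k)
    · intro j hj
      exact not_lt.1 (Finset.mem_filter.1 hj).2

/-- A subadditive set function is bounded by peeling off the dyadic levels of `f`. -/
lemma dyadic_peel {ι : Type*} {f : ι → ℝ} {g : Finset ι → ℝ} {u : ℕ → ℝ} {G₀ b ρ : ℝ}
    {S₀ : Finset ι} (hg : ∀ S : Finset ι, ∀ v, g S ≤ g {j ∈ S | v < f j} + g {j ∈ S | ¬ v < f j})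
    (h0 : ∀ S ⊆ S₀, S.card ≤ 1 → g S ≤ G₀)
    (hu : ∀ i, (Finset.card {j ∈ S₀ | u i < f j}) ≤ 2 ^ i)
    (hB : ∀ i, ∀ S ⊆ S₀, S.card ≤ 2 ^ (i + 1) → (∀ j ∈ S, f j ≤ u i) → g S ≤ b * ρ ^ i)
    (hb : 0 ≤ b) (hρ : 0 ≤ ρ) (hρ1 : ρ < 1) : g S₀ ≤ G₀ + b * (1 - ρ)⁻¹ := by
  refine (dyadic_peel_aux hg h0 hu hB S₀.card S₀ subset_rfl Nat.lt_two_pow_self.le).trans ?_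
  rw [← Finset.mul_sum, ← tsum_geometric_of_lt_one hρ hρ1]
  gcongr
  exact (summable_geometric_of_lt_one hρ hρ1).sum_le_tsum _ fun i _ => by positivity

lemma sum_rpow_le_of_card_levels_le {ι : Type*} {a : ι → ℝ} {r : ℝ} (hr : 1 ≤ r) {n : ℕ}
    (L : Finset ι) (ha : ∀ j ∈ L, 0 ≤ a j)
    (hn : ∀ v > 0, (Finset.card {j ∈ L | v < a j ∧ a j ≤ 2 * v}) ≤ n) :
    ∀ W : ℝ, 0 ≤ W → (∀ j ∈ L, a j ≤ W) → ∑ j ∈ L, a j ^ r ≤ 2 * n * W ^ r := by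
  induction L using Finset.strongInduction with
  | H L ih =>
  intro W hW haW
  rcases L.eq_empty_or_nonempty with rfl | hL
  · simp; positivity
  obtain ⟨j₀, hj₀, hmax⟩ := L.exists_max_image a hL
  rcases (ha j₀ hj₀).eq_or_lt with h0 | h0
  · rw [Finset.sum_eq_zero fun j hj => ?_]
    · positivity
    · rw [le_antisymm ((hmax j hj).trans h0.symm.le) (ha j hj), Real.zero_rpow (by linarith)]
  set V := a j₀
  rw [← Finset.sum_filter_add_sum_filter_not L fun j => V / 2 < a j]
  have h1 : ∑ j ∈ L with V / 2 < a j, a j ^ r ≤ n * V ^ r := by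
    calc _ ≤ ∑ j ∈ L with V / 2 < a j, V ^ r := by
          refine Finset.sum_le_sum fun j hj => ?_
          have hj := (Finset.mem_filter.1 hj).1
          exact Real.rpow_le_rpow (ha j hj) (hmax j hj) (by linarith)
      _ ≤ _ := by
          rw [Finset.sum_const, nsmul_eq_mul]
          gcongr
          refine le_trans (Finset.card_le_card fun j hj => ?_) (hn (V / 2) (by positivity))
          have hj := Finset.mem_filter.1 hj
          refine Finset.mem_filter.2 ⟨hj.1, hj.2, ?_⟩
          have := hmax j hj.1
          linarith
  have h2 : ∑ j ∈ L with ¬ V / 2 < a j, a j ^ r ≤ 2 * n * (V / 2) ^ r := by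
    refine ih _ ?_ (fun j hj => ha j (Finset.mem_filter.1 hj).1) (fun v hv => ?_) _ (by positivity)
      fun j hj => not_lt.1 (Finset.mem_filter.1 hj).2
    · refine Finset.filter_ssubset.2 ⟨j₀, hj₀, ?_⟩
      rw [not_not]
      exact half_lt_self h0
    · exact (Finset.card_le_card (Finset.filter_subset_filter _ (Finset.filter_subset _ _))).trans
        (hn v hv)
  have h3 : (V / 2) ^ r ≤ V ^ r / 2 := by
    rw [Real.div_rpow h0.le (by norm_num)]
    gcongr
    simpa using Real.rpow_le_rpow_of_exponent_le (one_le_two (α := ℝ)) hr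
  have h4 : V ^ r ≤ W ^ r := Real.rpow_le_rpow h0.le (haW _ hj₀) (by linarith)
  nlinarith [(Nat.cast_nonneg n : (0 : ℝ) ≤ n)]

lemma exists_maximal_disjoint_family {ι : Type*} [DecidableEq ι] (S : Finset ι)
    (p : Finset ι → Prop) (hp : ¬ p ∅) :
    ∃ 𝒜 : Finset (Finset ι), (𝒜 : Set (Finset ι)).PairwiseDisjoint id ∧
      (∀ A ∈ 𝒜, A ⊆ S ∧ p A) ∧ ∀ A ⊆ S \ 𝒜.biUnion id, ¬ p A := by
  classical
  obtain ⟨𝒜, h𝒜, hmax⟩ := Finset.exists_max_image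
    (Finset.filter (fun 𝒜 : Finset (Finset ι) =>
      (𝒜 : Set (Finset ι)).PairwiseDisjoint id ∧ ∀ A ∈ 𝒜, p A) S.powerset.powerset)
    Finset.card ⟨∅, by simp⟩
  simp only [Finset.mem_filter, Finset.mem_powerset] at h𝒜 hmax
  refine ⟨𝒜, h𝒜.2.1, fun A hA => ⟨Finset.mem_powerset.1 (h𝒜.1 hA), h𝒜.2.2 A hA⟩, fun A hA hpA => ?_⟩
  have hdisj : ∀ B ∈ 𝒜, Disjoint A B := fun B hB =>
    (Finset.disjoint_of_subset_left hA Finset.sdiff_disjoint).mono_right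
      (Finset.subset_biUnion_of_mem id hB)
  have hA𝒜 : A ∉ 𝒜 := fun h => by
    have := hdisj A h
    rw [Finset.disjoint_self_iff_empty] at this
    exact hp (this ▸ hpA)
  have := hmax (insert A 𝒜) ⟨?_, ?_, ?_⟩
  · rw [Finset.card_insert_of_notMem hA𝒜] at this
    omega
  · exact Finset.insert_subset (Finset.mem_powerset.2 (hA.trans Finset.sdiff_subset)) h𝒜.1
  · rw [Finset.coe_insert]
    exact h𝒜.2.1.insert fun B hB _ => hdisj B hB
  · simpa [hpA] using h𝒜.2.2

section Summing

variable {Y : Type*} [NormedAddCommGroup Y] [NormedSpace ℝ Y]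

/-- If no `n` vectors of norms in `[1, 2]` span a block with weak norms dominated by
`4 |A| ^ (1 / r)`, then the identity of `Y` satisfies an `(r, 1)`-summing inequality. -/
lemma sum_norm_rpow_le_weakNorm {r : ℝ} (hr : 1 ≤ r) {n : ℕ}
    (H : ∀ y : Fin n → Y, (∀ j, 1 ≤ ‖y j‖) → (∀ j, ‖y j‖ ≤ 2) →
      ∃ A : Finset (Fin n), 4 * (A.card : ℝ) ^ (1 / r) < weakNorm A y) (N : ℕ) :
    ∀ {ι : Type} (S : Finset ι) (x : ι → Y), S.card ≤ N →
      ∑ j ∈ S, ‖x j‖ ^ r ≤ 4 * n * weakNorm S x ^ r := by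
  have hr0 : 0 < r := by linarith
  induction N with
  | zero =>
    intro ι S x hS
    obtain rfl : S = ∅ := Finset.card_eq_zero.1 (by omega)
    have := weakNorm_nonneg ∅ x
    simp only [Finset.sum_empty]
    positivity
  | succ N ih =>
  intro ι S x hS
  classical
  set W := weakNorm S x
  have hW : 0 ≤ W := weakNorm_nonneg S x
  set bad : Finset ι → Prop := fun A =>
    ∃ δ : ι → ℤˣ, 2 * ∑ j ∈ A, ‖x j‖ ^ r < ‖∑ j ∈ A, δ j • x j‖ ^ r
  have hbad0 : ¬ bad ∅ := by rintro ⟨δ, h⟩; simp [Real.zero_rpow hr0.ne'] at h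
  have hbad : ∀ A, bad A → 2 ≤ A.card := by
    rintro A hA
    by_contra! hc
    have : A.card ≠ 0 := fun h => hbad0 (Finset.card_eq_zero.1 h ▸ hA)
    obtain ⟨i, rfl⟩ := Finset.card_eq_one.1 (by omega : A.card = 1)
    obtain ⟨δ, h⟩ := hA
    simp only [Finset.sum_singleton, norm_units_zsmul] at h
    have : 0 ≤ ‖x i‖ ^ r := by positivity
    linarith
  obtain ⟨𝒜, hd, h𝒜, hL⟩ := exists_maximal_disjoint_family S bad hbad0
  set L := S \ 𝒜.biUnion id
  have hsub : 𝒜.biUnion id ⊆ S := Finset.biUnion_subset.2 fun A hA => (h𝒜 A hA).1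
  have hcard : 2 * 𝒜.card ≤ S.card := by
    rw [mul_comm, ← smul_eq_mul]
    calc 𝒜.card • 2 ≤ ∑ A ∈ 𝒜, A.card :=
          Finset.card_nsmul_le_sum _ _ _ fun A hA => hbad A (h𝒜 A hA).2
      _ = (𝒜.biUnion id).card := (Finset.card_biUnion hd).symm
      _ ≤ S.card := Finset.card_le_card hsub
  have hδ : ∀ A, ∃ δ : ι → ℤˣ, A ∈ 𝒜 → 2 * ∑ j ∈ A, ‖x j‖ ^ r < ‖∑ j ∈ A, δ j • x j‖ ^ r :=
    fun A => by
      by_cases hA : A ∈ 𝒜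
      · obtain ⟨δ, h⟩ := (h𝒜 A hA).2
        exact ⟨δ, fun _ => h⟩
      · exact ⟨1, fun h => absurd h hA⟩
  choose δ hδ using hδ
  have hblocks : ∑ j ∈ 𝒜.biUnion id, ‖x j‖ ^ r ≤ 2 * n * W ^ r := by
    rw [Finset.sum_biUnion hd]
    have h1 : ∑ A ∈ 𝒜, ‖∑ j ∈ A, δ A j • x j‖ ^ r ≤ 4 * n * W ^ r := by
      refine (ih 𝒜 (fun A => ∑ j ∈ A, δ A j • x j) ?_).trans ?_
      · rcases 𝒜.card.eq_zero_or_pos with h | h <;> omega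
      · gcongr
        · exact weakNorm_nonneg _ _
        · exact weakNorm_blocks_le S x 𝒜 hd (fun A hA => (h𝒜 A hA).1) δ
    have h2 : 2 * ∑ A ∈ 𝒜, ∑ j ∈ id A, ‖x j‖ ^ r ≤ ∑ A ∈ 𝒜, ‖∑ j ∈ A, δ A j • x j‖ ^ r := by
      rw [Finset.mul_sum]
      exact Finset.sum_le_sum fun A hA => (hδ A hA).le
    linarith
  have hleft : ∑ j ∈ L, ‖x j‖ ^ r ≤ 2 * n * W ^ r := by
    refine sum_rpow_le_of_card_levels_le hr L (fun _ _ => norm_nonneg _) (fun v hv => ?_) W hW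
      fun j hj => norm_le_weakNorm x (Finset.sdiff_subset hj)
    by_contra! hlt
    obtain ⟨M, hM, hMn⟩ := Finset.exists_subset_card_eq hlt.le
    have hmem : ∀ j ∈ M, j ∈ L ∧ v < ‖x j‖ ∧ ‖x j‖ ≤ 2 * v := fun j hj =>
      Finset.mem_filter.1 (hM hj)
    let e : Fin n ↪ ι := (M.equivFinOfCardEq hMn).symm.toEmbedding.trans
      (Function.Embedding.subtype _)
    have he : ∀ i, e i ∈ M := fun i => ((M.equivFinOfCardEq hMn).symm i).2
    obtain ⟨A, hA⟩ := H (fun i => v⁻¹ • (x ∘ e) i)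
      (fun i => by
        rw [norm_smul, norm_inv, Real.norm_of_nonneg hv.le, ← div_eq_inv_mul, one_le_div hv]
        exact (hmem _ (he i)).2.1.le)
      (fun i => by
        rw [norm_smul, norm_inv, Real.norm_of_nonneg hv.le, ← div_eq_inv_mul, div_le_iff₀ hv]
        exact (hmem _ (he i)).2.2)
    rw [weakNorm_smul _ _ (inv_nonneg.2 hv.le), ← weakNorm_map, ← div_eq_inv_mul,
      lt_div_iff₀ hv] at hA
    obtain ⟨η, hη⟩ := exists_signs_lt_norm hA
    refine hL (A.map e) (fun j hj => ?_) ⟨η, lt_of_le_of_lt ?_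
      (Real.rpow_lt_rpow (by positivity) hη hr0)⟩
    · obtain ⟨i, -, rfl⟩ := Finset.mem_map.1 hj
      exact (hmem _ (he i)).1
    · have h1 : ∑ j ∈ A.map e, ‖x j‖ ^ r ≤ A.card * (2 * v) ^ r := by
        rw [Finset.sum_map, ← nsmul_eq_mul]
        refine Finset.sum_le_card_nsmul _ _ _ fun i _ => ?_
        exact Real.rpow_le_rpow (norm_nonneg _) (hmem _ (he i)).2.2 hr0.le
      have h2 : (4 * (A.card : ℝ) ^ (1 / r) * v) ^ r = 2 ^ r * (A.card * (2 * v) ^ r) := by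
        rw [show 4 * (A.card : ℝ) ^ (1 / r) * v = 2 * ((A.card : ℝ) ^ (1 / r) * (2 * v)) by ring,
          Real.mul_rpow (by norm_num) (by positivity), Real.mul_rpow (by positivity) (by positivity),
          ← Real.rpow_mul (by positivity), one_div, inv_mul_cancel₀ hr0.ne', Real.rpow_one]
      rw [h2]
      have h3 : (2 : ℝ) ≤ 2 ^ r := by
        simpa using Real.rpow_le_rpow_of_exponent_le (one_le_two (α := ℝ)) hr
      exact mul_le_mul h3 h1 (Finset.sum_nonneg fun _ _ => by positivity) (by positivity)
  rw [← Finset.sum_sdiff hsub]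
  linarith

/-- Weak-norm bounds on subsets give an upper estimate for every smaller exponent. -/
lemma norm_sum_smul_le_of_weakNorm_le {ι : Type*} {S₀ : Finset ι} {y : ι → Y} {p r : ℝ}
    (hp : 0 < p) (hpr : p < r) (hy : ∀ A ⊆ S₀, weakNorm A y ≤ 4 * (A.card : ℝ) ^ (1 / r))
    (c : ι → ℝ) :
    ‖∑ j ∈ S₀, c j • y j‖ ≤
      (4 + 4 * 2 ^ (1 / r) * (1 - 2 ^ (1 / r - 1 / p))⁻¹) * (∑ j ∈ S₀, |c j| ^ p) ^ (1 / p) := by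
  have hr : 0 < r := hp.trans hpr
  set w := (∑ j ∈ S₀, |c j| ^ p) ^ (1 / p)
  have hsum : 0 ≤ ∑ j ∈ S₀, |c j| ^ p := Finset.sum_nonneg fun _ _ => by positivity
  have hw : 0 ≤ w := by positivity
  have hwp : w ^ p = ∑ j ∈ S₀, |c j| ^ p := by
    rw [← Real.rpow_mul hsum, one_div, inv_mul_cancel₀ hp.ne', Real.rpow_one]
  have hρ : (2 : ℝ) ^ (1 / r - 1 / p) < 1 :=
    Real.rpow_lt_one_of_one_lt_of_neg one_lt_two (sub_neg.2 (one_div_lt_one_div_of_lt hp hpr))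
  have hu0 : ∀ i : ℕ, 0 ≤ w * (2 : ℝ) ^ (-(i / p)) := fun i => by positivity
  have hc1 : ∀ j ∈ S₀, |c j| ≤ w := fun j hj => by
    rw [← Real.rpow_le_rpow_iff (abs_nonneg _) hw hp, hwp]
    exact Finset.single_le_sum (f := fun j => |c j| ^ p) (fun _ _ => by positivity) hj
  have := dyadic_peel (S₀ := S₀) (f := fun j => |c j|) (g := fun S => ‖∑ j ∈ S, c j • y j‖)
    (u := fun i => w * 2 ^ (-(i / p))) (G₀ := 4 * w) (b := 4 * 2 ^ (1 / r) * w)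
    (ρ := 2 ^ (1 / r - 1 / p)) ?_ ?_ ?_ ?_ (by positivity) (by positivity) hρ
  · refine this.trans (le_of_eq ?_)
    ring
  · intro S v
    rw [← Finset.sum_filter_add_sum_filter_not S fun j => v < |c j|]
    exact norm_add_le _ _
  · intro S hS hcard
    refine (norm_sum_smul_le (fun j hj => hc1 j (hS hj)) hw).trans ?_
    rw [mul_comm]
    gcongr
    refine (hy S hS).trans ?_
    have : (S.card : ℝ) ^ (1 / r) ≤ 1 :=
      Real.rpow_le_one (by positivity) (by exact_mod_cast hcard) (by positivity)
    linarith
  · intro i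
    by_contra! hlt
    have hne : (Finset.filter (fun j => w * 2 ^ (-(i / p)) < |c j|) S₀).Nonempty :=
      Finset.card_pos.1 ((Nat.zero_le _).trans_lt hlt)
    have h1 : (Finset.card {j ∈ S₀ | w * 2 ^ (-(i / p)) < |c j|}) * (w * 2 ^ (-(i / p))) ^ p
        < w ^ p := by
      rw [hwp, ← nsmul_eq_mul, ← Finset.sum_const]
      refine lt_of_lt_of_le (Finset.sum_lt_sum_of_nonempty hne fun j hj => ?_)
        (Finset.sum_le_sum_of_subset_of_nonneg (Finset.filter_subset _ _)
          (f := fun j => |c j| ^ p) fun _ _ _ => by positivity)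
      exact Real.rpow_lt_rpow (hu0 i) (Finset.mem_filter.1 hj).2 hp
    have h2 : (w * 2 ^ (-(i / p))) ^ p * 2 ^ i = w ^ p := by
      rw [Real.mul_rpow hw (by positivity), ← Real.rpow_mul zero_le_two, neg_mul,
        div_mul_cancel₀ _ hp.ne', mul_assoc, ← Real.rpow_natCast 2 i, ← Real.rpow_add two_pos]
      simp
    have h3 : ((2 : ℝ) ^ i) < (Finset.card {j ∈ S₀ | w * 2 ^ (-(i / p)) < |c j|}) := by
      exact_mod_cast hlt
    have h4 : 0 ≤ (w * (2 : ℝ) ^ (-(i / p))) ^ p := by have := hu0 i; positivity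
    nlinarith
  · intro i S hS hcard hSu
    refine (norm_sum_smul_le hSu (hu0 i)).trans ?_
    have h1 : (S.card : ℝ) ^ (1 / r) ≤ 2 ^ (1 / r) * 2 ^ (i / r) := by
      rw [← Real.rpow_add two_pos]
      have : (S.card : ℝ) ≤ (2 : ℝ) ^ ((i : ℝ) + 1) := by
        exact_mod_cast hcard
      refine (Real.rpow_le_rpow (by positivity) this (by positivity)).trans (le_of_eq ?_)
      rw [← Real.rpow_mul (by norm_num)]
      congr 1
      ring
    calc w * 2 ^ (-(i / p)) * weakNorm S y
        ≤ w * 2 ^ (-(i / p)) * (4 * (2 ^ (1 / r) * 2 ^ (i / r))) := by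
          have := hu0 i
          have h2 := hy S hS
          gcongr
          linarith
      _ = _ := by
          rw [← Real.rpow_natCast, ← Real.rpow_mul (by norm_num),
            show (1 / r - 1 / p) * (i : ℝ) = -(i / p) + i / r by ring, Real.rpow_add two_pos]
          ring

end Summing

lemma sqrt_sum_add_sq_le {ι : Type*} (s : Finset ι) (a b : ι → ℝ) :
    √(∑ i ∈ s, (a i + b i) ^ 2) ≤ √(∑ i ∈ s, a i ^ 2) + √(∑ i ∈ s, b i ^ 2) := by
  refine Real.sqrt_le_iff.2 ⟨by positivity, ?_⟩
  have h := Real.sum_mul_le_sqrt_mul_sqrt s a b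
  rw [add_sq, Real.sq_sqrt (Finset.sum_nonneg fun _ _ => sq_nonneg _),
    Real.sq_sqrt (Finset.sum_nonneg fun _ _ => sq_nonneg _)]
  simp only [add_sq, Finset.sum_add_distrib, mul_assoc, ← Finset.mul_sum]
  linarith

/-- Exchange of a sign pattern between the two halves of each block. -/
def twistEquiv {P J : Type*} (ε : P → J → ℤˣ) : (P × ℤˣ) × J ≃ P × (ℤˣ × J) where
  toFun z := (z.1.1, (z.1.2 * ε z.1.1 z.2, z.2))
  invFun z := ((z.1, z.2.1 * ε z.1 z.2.2), z.2.2)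
  left_inv z := by simp [mul_assoc]
  right_inv z := by simp [mul_assoc]

section Blocks

variable {Y : Type*} [NormedAddCommGroup Y] [NormedSpace ℝ Y]

lemma weakNorm_univ_comp_equiv {ι κ : Type*} [Fintype ι] [Fintype κ] (e : κ ≃ ι) (x : ι → Y) :
    weakNorm Finset.univ (fun j => x (e j)) = weakNorm Finset.univ x := by
  unfold weakNorm
  congr 1
  ext φ
  exact Equiv.sum_comp e fun j => |φ.1 (x j)|

/-- A finite family can be split into blocks whose weak norms are controlled by the Rademacher
average, provided that short families satisfy a quadratic lower estimate. -/
lemma exists_blocks {D : ℝ} {ι : Type*} [Fintype ι] [DecidableEq ι] (x : ι → Y) (l : ℕ) :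
    ∀ n : ℕ, Fintype.card ι = 2 ^ (l + n) →
    (∀ i < l, ∀ y : Fin (2 ^ i) → Y, ∑ j, ‖y j‖ ^ 2 ≤ D * rademacher y) →
    ∃ σ : Fin (2 ^ l) × Fin (2 ^ n) ≃ ι,
      √(∑ p, weakNorm Finset.univ (fun j => x (σ (p, j))) ^ 2)
        ≤ (√(2 ^ n) + 10 * √D) * √(rademacher x) := by
  induction l with
  | zero =>
    intro n hι _
    let σ : Fin (2 ^ 0) × Fin (2 ^ n) ≃ ι := Fintype.equivOfCardEq (by simp [hι])
    refine ⟨σ, ?_⟩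
    have h : ∀ p, weakNorm Finset.univ (fun j => x (σ (p, j))) ≤ √(2 ^ n) * √(rademacher x) :=
      fun p => by
        refine (weakNorm_univ_le_sqrt_rademacher _).trans ?_
        rw [Fintype.card_fin]
        push_cast
        gcongr
        exact rademacher_comp_le x (fun j => σ (p, j))
          (σ.injective.comp (Prod.mk_right_injective p))
    have hsum : ∑ p, weakNorm Finset.univ (fun j => x (σ (p, j))) ^ 2
        = weakNorm Finset.univ (fun j => x (σ (0, j))) ^ 2 := Fin.sum_univ_one _
    rw [hsum, Real.sqrt_sq (weakNorm_nonneg _ _)]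
    refine (h 0).trans ?_
    gcongr
    linarith [Real.sqrt_nonneg D]
  | succ l ih =>
    intro n hι hD
    obtain ⟨σ, hσ⟩ := ih (n + 1) (by rw [hι]; ring) fun i hi => hD i (by omega)
    let τ : ℤˣ × Fin (2 ^ n) ≃ Fin (2 ^ (n + 1)) :=
      Fintype.equivOfCardEq (by simp [pow_succ, mul_comm])
    let α : Fin (2 ^ (l + 1)) ≃ Fin (2 ^ l) × ℤˣ := Fintype.equivOfCardEq (by simp [pow_succ])
    choose ε hε using fun p => exists_halving fun z => x (σ (p, τ z))
    set M : Fin (2 ^ l) → ℝ := fun p => weakNorm Finset.univ fun j => x (σ (p, j))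
    set R : Fin (2 ^ l) → ℝ := fun p => √(rademacher fun z => x (σ (p, τ z)))
    let β : (Fin (2 ^ l) × (ℤˣ × Fin (2 ^ n))) ≃ ι := (Equiv.prodCongrRight fun _ => τ).trans σ
    refine ⟨(Equiv.prodCongrLeft fun _ => α).trans ((twistEquiv ε).trans β), ?_⟩
    have h1 : ∀ p b, weakNorm Finset.univ (fun j => x (β (twistEquiv ε ((p, b), j))))
        ≤ M p / 2 + 2 * R p := fun p b => by
      refine (hε p b).trans (le_of_eq ?_)
      rw [weakNorm_univ_comp_equiv τ fun j => x (σ (p, j))]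
    have h2 : ∑ q, weakNorm Finset.univ (fun j => x (β (twistEquiv ε (α q, j)))) ^ 2
        ≤ 2 * ∑ p, (M p / 2 + 2 * R p) ^ 2 := by
      rw [Equiv.sum_comp α fun q => weakNorm Finset.univ (fun j => x (β (twistEquiv ε (q, j)))) ^ 2,
        Fintype.sum_prod_type, Finset.mul_sum]
      refine Finset.sum_le_sum fun p _ => ?_
      calc _ ≤ ∑ _b : ℤˣ, (M p / 2 + 2 * R p) ^ 2 :=
            Finset.sum_le_sum fun b _ => pow_le_pow_left₀ (weakNorm_nonneg _ _) (h1 p b) 2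
        _ = _ := by simp
    have h3 : √(∑ p, R p ^ 2) ≤ √D * √(rademacher x) := by
      have hle : ∑ p, R p ^ 2 ≤ D * rademacher fun z => x (β z) := by
        simp only [R, Real.sq_sqrt (rademacher_nonneg _)]
        exact sum_rademacher_blocks_le (hD l (Nat.lt_succ_self l)) fun z => x (β z)
      have hrad : rademacher (fun z => x (β z)) ≤ rademacher x :=
        rademacher_comp_le x β β.injective
      rcases le_or_gt 0 D with hD0 | hD0
      · rw [← Real.sqrt_mul hD0]
        exact Real.sqrt_le_sqrt (hle.trans (mul_le_mul_of_nonneg_left hrad hD0))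
      · rw [Real.sqrt_eq_zero'.2]
        · positivity
        · nlinarith [rademacher_nonneg fun z => x (β z)]
    have h4 : √(∑ p, (M p / 2 + 2 * R p) ^ 2) ≤ √(∑ p, M p ^ 2) / 2 + 2 * √(∑ p, R p ^ 2) := by
      refine (sqrt_sum_add_sq_le _ _ _).trans (le_of_eq ?_)
      simp only [div_pow, mul_pow, ← Finset.sum_div, ← Finset.mul_sum]
      rw [Real.sqrt_div (Finset.sum_nonneg fun _ _ => sq_nonneg _),
        Real.sqrt_mul (by positivity), Real.sqrt_sq zero_le_two]
    have hn : √((2 : ℝ) ^ (n + 1)) = √2 * √(2 ^ n) := by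
      rw [pow_succ, mul_comm, Real.sqrt_mul zero_le_two]
    have h22 : √2 * √2 = (2 : ℝ) := Real.mul_self_sqrt zero_le_two
    have h2le : 7 * √2 ≤ (10 : ℝ) := by nlinarith [Real.sqrt_nonneg 2]
    calc _ ≤ √(2 * ∑ p, (M p / 2 + 2 * R p) ^ 2) := Real.sqrt_le_sqrt h2
      _ = √2 * √(∑ p, (M p / 2 + 2 * R p) ^ 2) := Real.sqrt_mul zero_le_two _
      _ ≤ √2 * ((√(2 ^ (n + 1)) + 10 * √D) * √(rademacher x) / 2
            + 2 * (√D * √(rademacher x))) := by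
          gcongr
          linarith
      _ = (√2 * √2 / 2 * √(2 ^ n) + 7 * √2 * √D) * √(rademacher x) := by rw [hn]; ring
      _ ≤ _ := by
          rw [h22]
          gcongr
          linarith

lemma exists_sum_sq_le_rademacher {K θ θ' : ℝ} (hK : 0 ≤ K) (hθ : 0 ≤ θ) (hθ' : θ < θ')
    (hM : ∀ h : ℕ, ∀ x : Fin (2 ^ h) → Y,
      ∑ j, ‖x j‖ ^ 2 ≤ (K * 2 ^ (h * θ)) ^ 2 * weakNorm Finset.univ x ^ 2) :
    ∃ C : ℝ, 0 ≤ C ∧ ∀ k : ℕ, ∀ x : Fin (2 ^ k) → Y,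
      ∑ j, ‖x j‖ ^ 2 ≤ (C * 2 ^ (k * θ')) ^ 2 * rademacher x := by
  obtain ⟨h, hh⟩ : ∃ h : ℕ, 20 * K ≤ ((2 : ℝ) ^ (θ' - θ)) ^ h := by
    obtain ⟨h, hh⟩ := pow_unbounded_of_one_lt (20 * K)
      (Real.one_lt_rpow one_lt_two (sub_pos.2 hθ'))
    exact ⟨h, hh.le⟩
  obtain ⟨h, hh0, hh⟩ : ∃ h : ℕ, 0 < h ∧ 20 * K ≤ ((2 : ℝ) ^ (θ' - θ)) ^ h :=
    ⟨h + 1, h.succ_pos, hh.trans (pow_le_pow_right₀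
      (Real.one_le_rpow one_le_two (sub_pos.2 hθ').le) h.le_succ)⟩
  have hθ0 : 0 ≤ θ' := hθ.trans hθ'.le
  have hKh : 20 * (K * 2 ^ (h * θ)) ≤ (2 : ℝ) ^ (h * θ') := by
    rw [← Real.rpow_natCast, ← Real.rpow_mul zero_le_two] at hh
    calc 20 * (K * 2 ^ (h * θ)) = 20 * K * 2 ^ (h * θ) := by ring
      _ ≤ 2 ^ ((θ' - θ) * h) * 2 ^ (h * θ) := by gcongr
      _ = _ := by rw [← Real.rpow_add two_pos]; congr 1; ring
  set L := K * (2 : ℝ) ^ (h * θ)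
  have hL : 0 ≤ L := by positivity
  set C := 2 * L * √(2 ^ h) + √(2 ^ h)
  have hC : 0 ≤ C := by positivity
  have hone : ∀ k : ℕ, (1 : ℝ) ≤ 2 ^ (k * θ') := fun k =>
    Real.one_le_rpow one_le_two (by positivity)
  refine ⟨C, hC, fun k => ?_⟩
  induction k using Nat.strong_induction_on with
  | _ k ih =>
  intro x
  rcases lt_or_ge k h with hk | hk
  · calc ∑ j, ‖x j‖ ^ 2 ≤ ∑ _j : Fin (2 ^ k), rademacher x := by
          refine Finset.sum_le_sum fun j _ => ?_
          rw [← Real.sq_sqrt (rademacher_nonneg x)]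
          exact pow_le_pow_left₀ (norm_nonneg _) (norm_le_sqrt_rademacher x j) 2
      _ = 2 ^ k * rademacher x := by simp
      _ ≤ (C * 2 ^ (k * θ')) ^ 2 * rademacher x := by
          refine mul_le_mul_of_nonneg_right ?_ (rademacher_nonneg x)
          have h1 : (2 : ℝ) ^ k ≤ √(2 ^ h) ^ 2 := by
            rw [Real.sq_sqrt (by positivity)]
            exact pow_le_pow_right₀ one_le_two hk.le
          refine h1.trans (pow_le_pow_left₀ (by positivity) ?_ 2)
          have h2 : √(2 ^ h) ≤ C := le_add_of_nonneg_left (by positivity)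
          exact h2.trans (le_mul_of_one_le_right hC (hone k))
  · obtain ⟨l, rfl⟩ := Nat.exists_eq_add_of_le' hk
    obtain ⟨σ, hσ⟩ := exists_blocks (D := (C * 2 ^ (l * θ')) ^ 2) x l h (by simp) fun i hi y =>
      (ih i (by omega) y).trans <| by
        have := rademacher_nonneg y
        gcongr
        norm_num
    rw [Real.sqrt_sq (by positivity)] at hσ
    have h1 : ∑ p, weakNorm Finset.univ (fun j => x (σ (p, j))) ^ 2
        ≤ ((√(2 ^ h) + 10 * (C * 2 ^ (l * θ'))) * √(rademacher x)) ^ 2 :=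
      (Real.sqrt_le_left (by positivity)).1 hσ
    calc ∑ j, ‖x j‖ ^ 2 = ∑ p, ∑ j, ‖x (σ (p, j))‖ ^ 2 := by
          rw [← Equiv.sum_comp σ, Fintype.sum_prod_type]
      _ ≤ ∑ p, L ^ 2 * weakNorm Finset.univ (fun j => x (σ (p, j))) ^ 2 :=
          Finset.sum_le_sum fun p _ => hM h _
      _ ≤ L ^ 2 * ((√(2 ^ h) + 10 * (C * 2 ^ (l * θ'))) * √(rademacher x)) ^ 2 := by
          rw [← Finset.mul_sum]
          gcongr
      _ = (L * (√(2 ^ h) + 10 * (C * 2 ^ (l * θ')))) ^ 2 * rademacher x := by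
          rw [mul_pow _ √(rademacher x), Real.sq_sqrt (rademacher_nonneg x)]
          ring
      _ ≤ _ := by
          refine mul_le_mul_of_nonneg_right (pow_le_pow_left₀ (by positivity) ?_ 2)
            (rademacher_nonneg x)
          have h2 : (2 : ℝ) ^ (((l + h : ℕ) : ℝ) * θ') = 2 ^ (l * θ') * 2 ^ (h * θ') := by
            rw [← Real.rpow_add two_pos]; push_cast; congr 1; ring
          have h3 : C ≤ C * 2 ^ (((l + h : ℕ) : ℝ) * θ') := le_mul_of_one_le_right hC (hone _)
          have h4 : 20 * L * (C * 2 ^ (l * θ')) ≤ C * 2 ^ (((l + h : ℕ) : ℝ) * θ') := by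
            rw [h2]
            calc _ ≤ 2 ^ (h * θ') * (C * 2 ^ (l * θ')) := by gcongr
              _ = _ := by ring
          have h5 : 2 * L * √(2 ^ h) ≤ C := le_add_of_nonneg_right (by positivity)
          linarith

end Blocks

section Cotype

variable {Y : Type*} [NormedAddCommGroup Y]

lemma rademacher_eq_bool (k : ℕ) (x : Fin k → Y) :
    rademacher x = (2 ^ k : ℝ)⁻¹ * ∑ ε : Fin k → Bool, ‖∑ j, (if ε j then x j else -x j)‖ ^ 2 := by
  let b : Bool ≃ ℤˣ :=
    { toFun := fun b => if b then 1 else -1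
      invFun := fun u => decide (u = 1)
      left_inv := by decide
      right_inv := by decide }
  rw [rademacher, Fintype.expect_eq_sum_div_card, div_eq_inv_mul]
  congr 1
  · simp
  · refine (Fintype.sum_equiv (Equiv.piCongrRight fun _ => b) _ _ fun ε => ?_).symm
    congr 2
    refine Finset.sum_congr rfl fun j _ => ?_
    cases h : ε j <;> simp [b, h]

lemma hasCotype_of_sum_rpow_le {s C : ℝ} (hs : 0 < s) (hC : 0 ≤ C)
    (h : ∀ k : ℕ, ∀ x : Fin k → Y, ∑ j, ‖x j‖ ^ s ≤ C * √(rademacher x) ^ s) : HasCotype Y s := by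
  refine ⟨C ^ (1 / s), by positivity, fun k x => ?_⟩
  rw [← rademacher_eq_bool]
  refine (Real.rpow_le_rpow (Finset.sum_nonneg fun _ _ => by positivity) (h k x)
    (by positivity)).trans (le_of_eq ?_)
  rw [Real.mul_rpow hC (by positivity), ← Real.rpow_mul (by positivity), mul_one_div_cancel hs.ne',
    Real.rpow_one]

variable [NormedSpace ℝ Y]

lemma hasCotype_of_sum_sq_le {s θ C : ℝ} (hs : 0 < s) (hθ : θ < 1 / 2 - 1 / s)
    (hC : 0 ≤ C) (h : ∀ k : ℕ, ∀ x : Fin (2 ^ k) → Y,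
      ∑ j, ‖x j‖ ^ 2 ≤ (C * 2 ^ (k * θ)) ^ 2 * rademacher x) : HasCotype Y s := by
  set ρ : ℝ := 2 ^ (1 - s * (1 / 2 - θ))
  have hρ : ρ < 1 := by
    refine Real.rpow_lt_one_of_one_lt_of_neg one_lt_two ?_
    have : s * (1 / s) < s * (1 / 2 - θ) := by gcongr; linarith
    rw [mul_one_div_cancel hs.ne'] at this
    linarith
  have hρ' : 0 < 1 - ρ := sub_pos.2 hρ
  refine hasCotype_of_sum_rpow_le (C := 1 + 2 * C ^ s * (1 - ρ)⁻¹) hs (by positivity) fun k x => ?_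
  set R := √(rademacher x)
  have hR : 0 ≤ R := Real.sqrt_nonneg _
  have hR2 : R ^ 2 = rademacher x := Real.sq_sqrt (rademacher_nonneg x)
  have hu0 : ∀ i : ℕ, 0 ≤ C * R * (2 : ℝ) ^ (-(i * (1 / 2 - θ))) := fun i => by positivity
  have := dyadic_peel (S₀ := Finset.univ) (f := fun j => ‖x j‖) (g := fun S => ∑ j ∈ S, ‖x j‖ ^ s)
    (u := fun i => C * R * 2 ^ (-(i * (1 / 2 - θ)))) (G₀ := R ^ s) (b := 2 * (C * R) ^ s)
    (ρ := ρ) ?_ ?_ ?_ ?_ (by positivity) (by positivity) hρ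
  · refine this.trans (le_of_eq ?_)
    rw [Real.mul_rpow hC hR]
    ring
  · intro S v
    exact (Finset.sum_filter_add_sum_filter_not S _ _).ge
  · intro S _ hcard
    have h1 : ∀ j ∈ S, ‖x j‖ ^ s ≤ R ^ s := fun j _ =>
      Real.rpow_le_rpow (norm_nonneg _) (norm_le_sqrt_rademacher x j) hs.le
    refine (Finset.sum_le_card_nsmul _ _ _ h1).trans ?_
    rw [nsmul_eq_mul]
    exact mul_le_of_le_one_left (by positivity) (by exact_mod_cast hcard)
  · intro i
    by_contra! hlt
    obtain ⟨M, hM, hMn⟩ := Finset.exists_subset_card_eq hlt.le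
    let e : Fin (2 ^ i) ↪ Fin k := (M.equivFinOfCardEq hMn).symm.toEmbedding.trans
      (Function.Embedding.subtype _)
    have he : ∀ j, C * R * 2 ^ (-(i * (1 / 2 - θ))) < ‖x (e j)‖ := fun j =>
      (Finset.mem_filter.1 (hM ((M.equivFinOfCardEq hMn).symm j).2)).2
    have h1 : 2 ^ i * (C * R * 2 ^ (-(i * (1 / 2 - θ)))) ^ 2 < ∑ j, ‖x (e j)‖ ^ 2 := by
      calc _ = ∑ _j : Fin (2 ^ i), (C * R * (2 : ℝ) ^ (-(i * (1 / 2 - θ)))) ^ 2 := by simp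
        _ < _ := Finset.sum_lt_sum_of_nonempty Finset.univ_nonempty fun j _ =>
            pow_lt_pow_left₀ (he j) (hu0 i) two_ne_zero
    have h2 := (h i (x ∘ e)).trans (mul_le_mul_of_nonneg_left
      (rademacher_comp_le x e e.injective) (sq_nonneg _))
    refine (h1.trans_le h2).ne ?_
    have h3 : (2 : ℝ) ^ (i * θ) = √(2 ^ i) * 2 ^ (-(i * (1 / 2 - θ))) := by
      rw [Real.sqrt_eq_rpow, ← Real.rpow_natCast, ← Real.rpow_mul zero_le_two,
        ← Real.rpow_add two_pos]
      congr 1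
      ring
    rw [h3, ← hR2]
    simp only [mul_pow]
    rw [Real.sq_sqrt (show (0 : ℝ) ≤ 2 ^ i by positivity)]
    ring
  · intro i S _ hcard hSu
    refine (Finset.sum_le_card_nsmul _ _ _ fun j hj =>
      Real.rpow_le_rpow (norm_nonneg _) (hSu j hj) hs.le).trans ?_
    rw [nsmul_eq_mul]
    have h1 : (S.card : ℝ) ≤ 2 * 2 ^ i := by
      rw [← pow_succ']; exact_mod_cast hcard
    refine (mul_le_mul_of_nonneg_right h1 (by positivity)).trans (le_of_eq ?_)
    have h2 : ρ ^ i = 2 ^ i * ((2 : ℝ) ^ (-(i * (1 / 2 - θ)))) ^ s := by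
      simp only [ρ]
      rw [← Real.rpow_natCast, ← Real.rpow_natCast, ← Real.rpow_mul zero_le_two,
        ← Real.rpow_mul zero_le_two, ← Real.rpow_add two_pos]
      congr 1
      ring
    rw [Real.mul_rpow (by positivity) (by positivity), h2]
    ring

end Cotype

section UpperEstimates

variable {Y : Type*} [NormedAddCommGroup Y] [NormedSpace ℝ Y]

/-- Without cotype `s > 2`, the space contains blocks with upper `p`-estimates for every `p < s`. -/
lemma exists_upper_estimate_of_not_hasCotype {s p : ℝ} (hs : 2 < s) (hp : 0 < p) (hps : p < s)
    (hY : ¬ HasCotype Y s) :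
    ∃ C : ℝ, 0 ≤ C ∧ ∀ n : ℕ, ∃ y : Fin n → Y, (∀ j, 1 ≤ ‖y j‖) ∧
      ∀ c : Fin n → ℝ, ‖∑ j, c j • y j‖ ≤ C * (∑ j, |c j| ^ p) ^ (1 / p) := by
  obtain ⟨r, hr, hrs⟩ := exists_between (max_lt hps hs)
  obtain ⟨hpr, h2r⟩ := max_lt_iff.1 hr
  have hr0 : 0 < r := hp.trans hpr
  have hρ : (2 : ℝ) ^ (1 / r - 1 / p) < 1 :=
    Real.rpow_lt_one_of_one_lt_of_neg one_lt_two (sub_neg.2 (one_div_lt_one_div_of_lt hp hpr))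
  have hρ' : 0 < 1 - (2 : ℝ) ^ (1 / r - 1 / p) := sub_pos.2 hρ
  refine ⟨4 + 4 * 2 ^ (1 / r) * (1 - 2 ^ (1 / r - 1 / p))⁻¹, by positivity, fun n => ?_⟩
  suffices h : ∃ y : Fin n → Y, (∀ j, 1 ≤ ‖y j‖) ∧ (∀ j, ‖y j‖ ≤ 2) ∧
      ∀ A : Finset (Fin n), weakNorm A y ≤ 4 * (A.card : ℝ) ^ (1 / r) by
    obtain ⟨y, hy1, -, hy⟩ := h
    exact ⟨y, hy1, norm_sum_smul_le_of_weakNorm_le hp hpr fun A _ => hy A⟩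
  by_contra! H
  have hθ0 : 0 ≤ 1 / 2 - 1 / r := sub_nonneg.2 (one_div_le_one_div_of_le two_pos h2r.le)
  have hθs : 1 / 2 - 1 / r < 1 / 2 - 1 / s :=
    sub_lt_sub_left (one_div_lt_one_div_of_lt hr0 hrs) _
  obtain ⟨θ, hθ, hθ'⟩ := exists_between hθs
  have hM : ∀ h : ℕ, ∀ x : Fin (2 ^ h) → Y, ∑ j, ‖x j‖ ^ 2
      ≤ ((4 * n : ℝ) ^ (1 / r) * 2 ^ (h * (1 / 2 - 1 / r))) ^ 2 * weakNorm Finset.univ x ^ 2 := by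
    intro h x
    have h1 := sum_norm_rpow_le_weakNorm (by linarith) H _ Finset.univ x le_rfl
    have h2 := Real.rpow_sum_le_const_mul_sum_rpow_of_nonneg (s := Finset.univ) (p := r / 2)
      (f := fun j => ‖x j‖ ^ 2) (by linarith) fun j _ => by positivity
    have h3 : ∀ a : ℝ, 0 ≤ a → (a ^ 2) ^ (r / 2) = a ^ r := fun a ha => by
      rw [← Real.rpow_two, ← Real.rpow_mul ha]
      congr 1
      ring
    simp only [h3 _ (norm_nonneg _), Finset.card_univ, Fintype.card_fin] at h2
    have hW := weakNorm_nonneg Finset.univ x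
    rw [← Real.rpow_le_rpow_iff (z := r / 2) (Finset.sum_nonneg fun _ _ => by positivity)
      (by positivity) (by positivity), ← mul_pow, h3 _ (by positivity),
      Real.mul_rpow (by positivity) hW, Real.mul_rpow (by positivity) (by positivity),
      ← Real.rpow_mul (by positivity), one_div_mul_cancel hr0.ne', Real.rpow_one]
    refine h2.trans ((mul_le_mul_of_nonneg_left h1 (by positivity)).trans (le_of_eq ?_))
    have h4 : (((2 ^ h : ℕ) : ℝ)) ^ (r / 2 - 1) = ((2 : ℝ) ^ (h * (1 / 2 - 1 / r))) ^ r := by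
      push_cast
      rw [← Real.rpow_natCast, ← Real.rpow_mul zero_le_two, ← Real.rpow_mul zero_le_two]
      congr 1
      field_simp
    rw [h4]
    ring
  obtain ⟨C, hC, h⟩ := exists_sum_sq_le_rademacher (by positivity) hθ0 hθ hM
  exact hY (hasCotype_of_sum_sq_le (by linarith) hθ' hC h)

open scoped RealInnerProductSpace in
lemma exists_orthonormal_norm_apply_le {H : Type*} [NormedAddCommGroup H] [InnerProductSpace ℝ H]
    (u : H →L[ℝ] Y) {Λ : ℝ} {k : ℕ}
    (hk : ¬ ∃ f : Fin k → H, Orthonormal ℝ f ∧ ∀ i, Λ ≤ ‖u (f i)‖) :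
    ∃ l ≤ k, ∃ f : Fin l → H, Orthonormal ℝ f ∧
      ∀ x, (∀ i, ⟪x, f i⟫ = 0) → ‖u x‖ ≤ Λ * ‖x‖ := by
  by_contra! h
  suffices ∀ l ≤ k, ∃ f : Fin l → H, Orthonormal ℝ f ∧ ∀ i, Λ ≤ ‖u (f i)‖ from hk (this k le_rfl)
  intro l
  induction l with
  | zero => exact fun _ => ⟨Fin.elim0, ⟨fun i => i.elim0, fun i => i.elim0⟩, fun i => i.elim0⟩
  | succ l ih =>
    intro hl
    obtain ⟨f, hf, hfu⟩ := ih (by omega)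
    obtain ⟨x, hx, hxu⟩ := h l (by omega) f hf
    have hx0 : 0 < ‖x‖ := by
      rw [norm_pos_iff]
      rintro rfl
      simp at hxu
    refine ⟨Matrix.vecCons (‖x‖⁻¹ • x) f, orthonormal_vecCons_iff.2 ⟨?_, fun i => ?_, hf⟩,
      Fin.cases ?_ hfu⟩
    · rw [norm_smul, norm_inv, norm_norm, inv_mul_cancel₀ hx0.ne']
    · rw [real_inner_smul_left, hx, mul_zero]
    · rw [Matrix.cons_val_zero, map_smul, norm_smul, norm_inv, norm_norm, ← div_eq_inv_mul,
        le_div_iff₀ hx0]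
      exact hxu.le

open scoped RealInnerProductSpace in
lemma sum_sq_norm_apply_basis_le {k : ℕ}
    (hk : ∀ y : Fin k → Y, (∀ j, 1 ≤ ‖y j‖) →
      ∃ c : Fin k → ℝ, 2 * √(∑ j, c j ^ 2) < ‖∑ j, c j • y j‖) (n i : ℕ) :
    ∀ (u : EuclideanSpace ℝ (Fin n) →L[ℝ] Y) (Λ : ℝ), 0 ≤ Λ → (∀ x, ‖u x‖ ≤ Λ * ‖x‖) →
      ∑ j, ‖u (EuclideanSpace.single j 1)‖ ^ 2 ≤ (4 * k + n * (1 / 2) ^ i) * Λ ^ 2 := by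
  induction i with
  | zero =>
    intro u Λ hΛ hu
    calc ∑ j, ‖u (EuclideanSpace.single j 1)‖ ^ 2 ≤ ∑ _j : Fin n, Λ ^ 2 := by
          refine Finset.sum_le_sum fun j _ => pow_le_pow_left₀ (norm_nonneg _) ?_ 2
          simpa using hu (EuclideanSpace.single j 1)
      _ = n * Λ ^ 2 := by simp
      _ ≤ _ := by
          have : 0 ≤ (k : ℝ) * Λ ^ 2 := by positivity
          simp only [pow_zero, mul_one]
          linarith
  | succ i ih =>
    intro u Λ hΛ hu
    rcases hΛ.eq_or_lt with rfl | hΛ'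
    · have : ∀ x, u x = 0 := fun x => by simpa using hu x
      simp [this]
    obtain ⟨l, hl, f, hf, hfu⟩ := exists_orthonormal_norm_apply_le u (Λ := Λ / 2) (k := k) (by
      rintro ⟨f, hf, hfu⟩
      obtain ⟨c, hc⟩ := hk (fun j => (2 / Λ) • u (f j)) fun j => by
        rw [norm_smul, Real.norm_of_nonneg (by positivity), div_mul_eq_mul_div, one_le_div hΛ']
        linarith [hfu j]
      refine hc.not_ge ?_
      have h1 : ∑ j, c j • (2 / Λ) • u (f j) = (2 / Λ) • u (∑ j, c j • f j) := by
        simp [Finset.smul_sum, smul_comm (2 / Λ)]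
      have h2 : ‖∑ j, c j • f j‖ = √(∑ j, c j ^ 2) := by
        rw [norm_eq_sqrt_real_inner, hf.inner_sum]
        simp [sq]
      rw [h1, norm_smul, Real.norm_of_nonneg (by positivity), ← h2]
      calc 2 / Λ * ‖u (∑ j, c j • f j)‖ ≤ 2 / Λ * (Λ * ‖∑ j, c j • f j‖) := by gcongr; exact hu _
        _ = _ := by field_simp)
    set P : EuclideanSpace ℝ (Fin n) →L[ℝ] EuclideanSpace ℝ (Fin n) :=
      ∑ m, (innerSL ℝ (f m)).smulRight (f m)
    have hP : ∀ x, P x = ∑ m, ⟪f m, x⟫ • f m := fun x => by simp [P]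
    have horth : ∀ x m, ⟪x - P x, f m⟫ = 0 := fun x m => by
      rw [inner_sub_left, hP, hf.inner_left_fintype]
      simp [real_inner_comm]
    have hPn : ∀ x, ‖P x‖ ^ 2 = ∑ m, ⟪f m, x⟫ ^ 2 := fun x => by
      rw [← real_inner_self_eq_norm_sq, hP, hf.inner_sum]
      simp [sq]
    have hQ : ∀ x, ‖x - P x‖ ≤ ‖x‖ := fun x => by
      have h0 : ⟪x - P x, P x⟫ = 0 := by
        rw [hP x, inner_sum, ← hP x]
        simp [inner_smul_right, horth]
      have := norm_add_sq_real (x - P x) (P x)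
      rw [h0, sub_add_cancel] at this
      exact le_of_sq_le_sq (by linarith [sq_nonneg ‖P x‖]) (norm_nonneg _)
    have h1 := ih (u - u.comp P) (Λ / 2) (by positivity) fun x => by
      have : (u - u.comp P) x = u (x - P x) := by simp
      rw [this]
      exact (hfu _ (horth x)).trans (by gcongr; exact hQ x)
    have h2 : ∑ j, ‖u (P (EuclideanSpace.single j 1))‖ ^ 2 ≤ k * Λ ^ 2 := by
      calc _ ≤ ∑ j, Λ ^ 2 * ∑ m, ⟪f m, EuclideanSpace.single j (1 : ℝ)⟫ ^ 2 := by
            refine Finset.sum_le_sum fun j _ => ?_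
            rw [← hPn, ← mul_pow]
            exact pow_le_pow_left₀ (norm_nonneg _) (hu _) 2
        _ = Λ ^ 2 * ∑ m, ‖f m‖ ^ 2 := by
            rw [← Finset.mul_sum, Finset.sum_comm]
            simp [EuclideanSpace.inner_single_right, EuclideanSpace.real_norm_sq_eq]
        _ = l * Λ ^ 2 := by simp [hf.1, mul_comm]
        _ ≤ _ := by gcongr
    have h3 : ∀ z, ‖u z‖ ^ 2 ≤ 2 * ‖u (P z)‖ ^ 2 + 2 * ‖(u - u.comp P) z‖ ^ 2 := fun z => by
      have : ‖u z‖ ≤ ‖u (P z)‖ + ‖(u - u.comp P) z‖ := by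
        refine le_trans (le_of_eq ?_) (norm_add_le _ _)
        simp
      nlinarith [norm_nonneg (u z), sq_nonneg (‖u (P z)‖ - ‖(u - u.comp P) z‖)]
    calc _ ≤ ∑ j, (2 * ‖u (P (EuclideanSpace.single j 1))‖ ^ 2
          + 2 * ‖(u - u.comp P) (EuclideanSpace.single j 1)‖ ^ 2) :=
          Finset.sum_le_sum fun j _ => h3 _
      _ ≤ 2 * (k * Λ ^ 2) + 2 * ((4 * k + n * (1 / 2) ^ i) * (Λ / 2) ^ 2) := by
          rw [Finset.sum_add_distrib, ← Finset.mul_sum, ← Finset.mul_sum]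
          gcongr
      _ = _ := by ring

/-- Without cotype `2`, the space contains blocks with upper `2`-estimates. -/
lemma exists_upper_estimate_two_of_not_hasCotype (hY : ¬ HasCotype Y 2) (k : ℕ) :
    ∃ y : Fin k → Y, (∀ j, 1 ≤ ‖y j‖) ∧
      ∀ c : Fin k → ℝ, ‖∑ j, c j • y j‖ ≤ 2 * √(∑ j, c j ^ 2) := by
  by_contra! hk
  refine hY (hasCotype_of_sum_rpow_le (C := 4 * k) two_pos (by positivity) fun n x => ?_)
  simp only [Real.rpow_two]
  let u : EuclideanSpace ℝ (Fin n) →L[ℝ] Y :=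
    ∑ j, (EuclideanSpace.proj j : EuclideanSpace ℝ (Fin n) →L[ℝ] ℝ).smulRight (x j)
  have hu : ∀ z, u z = ∑ j, z j • x j := fun z => by simp [u]
  have hbound : ∀ z, ‖u z‖ ≤ √(rademacher x) * ‖z‖ := fun z => by
    obtain ⟨φ, hφ⟩ := exists_dualBall_eq_norm (u z)
    rw [← hφ, hu, map_sum]
    simp only [map_smul, smul_eq_mul]
    refine (Real.sum_mul_le_sqrt_mul_sqrt _ _ _).trans ?_
    rw [mul_comm, EuclideanSpace.norm_eq]
    simp only [Real.norm_eq_abs, sq_abs]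
    gcongr
    exact sum_sq_le_rademacher x φ.1 φ.2
  have hlim : Filter.Tendsto (fun i : ℕ => (4 * k + n * (1 / 2 : ℝ) ^ i) * √(rademacher x) ^ 2)
      Filter.atTop (nhds ((4 * k + n * 0) * √(rademacher x) ^ 2)) :=
    (((tendsto_pow_atTop_nhds_zero_of_lt_one (by norm_num) (by norm_num)).const_mul _).const_add
      _).mul_const _
  rw [mul_zero, add_zero] at hlim
  refine ge_of_tendsto' hlim fun i => ?_
  have := sum_sq_norm_apply_basis_le hk n i u _ (Real.sqrt_nonneg _) hbound
  simpa [hu, Pi.single_apply] using this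

end UpperEstimates

lemma IsNormalizedUncondBasis.exists_coord {𝕂 : Type*} [RCLike 𝕂] {X : Type*}
    [NormedAddCommGroup X] [NormedSpace 𝕂 X] {e : ℕ → X} (he : IsNormalizedUncondBasis 𝕂 X e) :
    ∃ (f : ℕ → X →L[𝕂] 𝕂) (M : ℝ), (∀ x, HasSum (fun n => f n x • e n) x) ∧
      (∀ (x : X) (a : ℕ → 𝕂), HasSum (fun n => a n • e n) x → ∀ j, f j x = a j) ∧
      ∀ j x, ‖f j x‖ ≤ M * ‖x‖ := by
  obtain ⟨hnorm, huniq, ρ, hρ, hunc⟩ := he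
  choose g hg hgu using huniq
  have hgu' : ∀ x a, HasSum (fun n => a n • e n) x → g x = a := fun x a h => (hgu x a h).symm
  have bound : ∀ j x, ‖g x j‖ ≤ (1 + ρ) / 2 * ‖x‖ := by
    intro j x
    have h1 : HasSum (fun n => (if n = j then (2 * g x j) • e j else 0)) ((2 * g x j) • e j) :=
      hasSum_ite_eq j _
    have h2 := (hg x).sub h1
    have h3 := hunc (g x) (fun n => if n = j then -1 else 1) x (x - (2 * g x j) • e j)
      (fun n => by by_cases h : n = j <;> simp [h]) (hg x) (by
        convert h2 using 2 with n
        by_cases h : n = j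
        · subst h
          simp only [if_true]
          rw [← sub_smul]
          congr 1
          ring
        · simp [h])
    have h4 : ‖(2 * g x j) • e j‖ ≤ ‖x‖ + ‖x - (2 * g x j) • e j‖ := by
      have := norm_sub_le x (x - (2 * g x j) • e j)
      simpa using this
    rw [norm_smul, hnorm, norm_mul, RCLike.norm_ofNat] at h4
    linarith
  refine ⟨fun j => LinearMap.mkContinuous
    { toFun := fun x => g x j
      map_add' := fun x y => ?_
      map_smul' := fun c x => ?_ } ((1 + ρ) / 2) (bound j), (1 + ρ) / 2, fun x => hg x,
      fun x a h j => congrFun (hgu' x a h) j, fun j x => bound j x⟩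
  · have := hgu' (x + y) (fun n => g x n + g y n) (by
      simpa only [add_smul] using (hg x).add (hg y))
    exact congrFun this j
  · have := hgu' (c • x) (fun n => c * g x n) (by
      simpa only [mul_smul] using (hg x).const_smul c)
    exact congrFun this j

lemma weaklySummable_of_hasSum {𝕂 : Type*} [RCLike 𝕂] {X : Type*}
    [NormedAddCommGroup X] [NormedSpace 𝕂 X] {u : ℕ → X} {x : X} (h : HasSum u x) :
    WeaklySummable 𝕂 u := fun φ => by
  have : Summable fun j => φ (u j) := (φ.hasSum h).summable
  exact this.norm

lemma norm_sum_smul_le_of_real {𝕂 : Type*} [RCLike 𝕂] {Y : Type*} [NormedAddCommGroup Y]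
    [NormedSpace 𝕂 Y] {n : ℕ} {y : Fin n → Y} {C r : ℝ} (hr : 0 < r) (hC : 0 ≤ C)
    (h : ∀ c : Fin n → ℝ, ‖∑ j, (c j : 𝕂) • y j‖ ≤ C * (∑ j, |c j| ^ r) ^ (1 / r))
    (c : Fin n → 𝕂) : ‖∑ j, c j • y j‖ ≤ 2 * C * (∑ j, ‖c j‖ ^ r) ^ (1 / r) := by
  have key : ∀ d : Fin n → ℝ, (∀ j, |d j| ≤ ‖c j‖) →
      ‖∑ j, (d j : 𝕂) • y j‖ ≤ C * (∑ j, ‖c j‖ ^ r) ^ (1 / r) := by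
    intro d hd
    refine (h d).trans ?_
    gcongr with j
    exact hd j
  have h1 := key (fun j => RCLike.re (c j)) fun j => RCLike.abs_re_le_norm _
  have h2 := key (fun j => RCLike.im (c j)) fun j => RCLike.abs_im_le_norm _
  have h3 : ∑ j, c j • y j = ∑ j, (RCLike.re (c j) : 𝕂) • y j +
      (RCLike.I : 𝕂) • ∑ j, (RCLike.im (c j) : 𝕂) • y j := by
    rw [Finset.smul_sum, ← Finset.sum_add_distrib]
    refine Finset.sum_congr rfl fun j _ => ?_
    rw [smul_smul, ← add_smul, mul_comm RCLike.I, RCLike.re_add_im]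
  rw [h3]
  refine (norm_add_le _ _).trans ?_
  have h4 : ‖(RCLike.I : 𝕂) • ∑ j, (RCLike.im (c j) : 𝕂) • y j‖ ≤
      1 * ‖∑ j, (RCLike.im (c j) : 𝕂) • y j‖ := by
    rw [norm_smul]
    gcongr
    by_cases hI : (RCLike.I : 𝕂) = 0
    · simp [hI]
    · exact (RCLike.norm_I_of_ne_zero hI).le
  linarith

/-- The conclusion of both alternatives on `Y`: for some `r > q` the space contains arbitrarily
long families of vectors, bounded below, satisfying a uniform upper `r`-estimate. -/
lemma exists_upper_estimate (𝕂 : Type*) [RCLike 𝕂] {Y : Type*} [NormedAddCommGroup Y]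
    [NormedSpace 𝕂 Y] {q : ℝ} (hq : 0 < q)
    (hY : (q < 1 ∧ Nontrivial Y ∧ FiniteDimensional 𝕂 Y) ∨
      (¬FiniteDimensional 𝕂 Y ∧ ∃ s : ℝ, 2 ≤ s ∧ q < s ∧ ¬HasCotype Y s)) :
    ∃ r C : ℝ, q < r ∧ 0 < C ∧ ∀ n, ∃ y : Fin n → Y, (∀ j, 1 ≤ ‖y j‖) ∧
      ∀ c : Fin n → 𝕂, ‖∑ j, c j • y j‖ ≤ C * (∑ j, ‖c j‖ ^ r) ^ (1 / r) := by
  let _ : NormedSpace ℝ Y := NormedSpace.restrictScalars ℝ 𝕂 Y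
  have hsm : ∀ (c : ℝ) (y : Y), c • y = (c : 𝕂) • y := fun c y => by
    rw [← algebraMap_smul 𝕂 c y]
  suffices ∃ r C : ℝ, q < r ∧ 0 ≤ C ∧ ∀ n, ∃ y : Fin n → Y, (∀ j, 1 ≤ ‖y j‖) ∧
      ∀ c : Fin n → ℝ, ‖∑ j, c j • y j‖ ≤ C * (∑ j, |c j| ^ r) ^ (1 / r) by
    obtain ⟨r, C, hr, hC, h⟩ := this
    refine ⟨r, 2 * (C + 1), hr, by positivity, fun n => ?_⟩
    obtain ⟨y, hy, hc⟩ := h n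
    refine ⟨y, hy, norm_sum_smul_le_of_real (hq.trans hr) (by positivity) fun c => ?_⟩
    simp only [← hsm]
    refine (hc c).trans ?_
    gcongr
    linarith
  rcases hY with ⟨hq1, hnt, -⟩ | ⟨-, s, hs2, hqs, hs⟩
  · obtain ⟨y₀, hy₀⟩ := NormedSpace.exists_lt_norm ℝ Y 1
    refine ⟨1, ‖y₀‖, hq1, norm_nonneg _, fun n => ⟨fun _ => y₀, fun _ => hy₀.le, fun c => ?_⟩⟩
    refine (norm_sum_le _ _).trans ?_
    simp [norm_smul, ← Finset.sum_mul, mul_comm]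
  · rcases hs2.eq_or_lt with rfl | hs2
    · refine ⟨2, 2, hqs, by norm_num, fun n => ?_⟩
      obtain ⟨y, hy, hc⟩ := exists_upper_estimate_two_of_not_hasCotype hs n
      refine ⟨y, hy, fun c => (hc c).trans (le_of_eq ?_)⟩
      rw [Real.sqrt_eq_rpow]
      simp
    · obtain ⟨C, hC, h⟩ := exists_upper_estimate_of_not_hasCotype (p := (q + s) / 2) hs2
        (by linarith) (by linarith) hs
      exact ⟨_, C, by linarith, hC, h⟩

lemma norm_sum_rpow_le {ι Y : Type*} [SeminormedAddCommGroup Y] {q : ℝ} (hq : 0 < q)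
    (s : Finset ι) (v : ι → Y) :
    ‖∑ i ∈ s, v i‖ ^ q ≤ (s.card : ℝ) ^ q * ∑ i ∈ s, ‖v i‖ ^ q := by
  rcases s.eq_empty_or_nonempty with rfl | hs
  · simp [hq.ne']
  · obtain ⟨i, hi, hmax⟩ := s.exists_max_image (fun i => ‖v i‖) hs
    calc ‖∑ i ∈ s, v i‖ ^ q ≤ (s.card * ‖v i‖) ^ q := by
          gcongr
          refine (norm_sum_le _ _).trans ?_
          simpa using Finset.sum_le_card_nsmul s (fun i => ‖v i‖) _ hmax
      _ = (s.card : ℝ) ^ q * ‖v i‖ ^ q := Real.mul_rpow (by positivity) (norm_nonneg _)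
      _ ≤ _ := by
          gcongr
          exact Finset.single_le_sum (f := fun i => ‖v i‖ ^ q) (fun _ _ => by positivity) hi

section UniformBound

variable {𝕂 : Type*} [RCLike 𝕂] {m : ℕ} {X : Fin m → Type*} [∀ k, NormedAddCommGroup (X k)]
  [∀ k, NormedSpace 𝕂 (X k)] {Y : Type*} [NormedAddCommGroup Y] [NormedSpace 𝕂 Y]

lemma norm_map_piecewise_neg (L : ContinuousMultilinearMap 𝕂 X Y) (s : Finset (Fin m))
    (u v : ∀ k, X k) :
    ‖L (s.piecewise u (-v))‖ = ‖L (s.piecewise u v)‖ := by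
  have h : s.piecewise u (-v) =
      fun k => (if k ∈ s then (1 : 𝕂) else -1) • s.piecewise u v k := by
    ext k
    by_cases hk : k ∈ s <;> simp [hk]
  rw [h, L.map_smul_univ, norm_smul, norm_prod, Finset.prod_eq_one fun k _ => ?_, one_mul]
  split_ifs <;> simp

lemma norm_map_rpow_le_sum_piecewise {q : ℝ} (hq : 0 < q) (L : ContinuousMultilinearMap 𝕂 X Y)
    (v w : ∀ k, X k) :
    ‖L w‖ ^ q ≤ ((2 : ℝ) ^ m) ^ q * ∑ s : Finset (Fin m), ‖L (v + s.piecewise w 0)‖ ^ q := by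
  have h1 : L w = ∑ s : Finset (Fin m), L (s.piecewise (v + w) (-v)) := by
    rw [← L.map_add_univ]
    congr 1
    abel
  rw [h1]
  refine (norm_sum_rpow_le hq _ _).trans (le_of_eq ?_)
  simp only [norm_map_piecewise_neg, Finset.card_univ, Fintype.card_finset, Fintype.card_fin]
  push_cast
  congr 1
  refine Finset.sum_congr rfl fun s _ => ?_
  congr 3
  ext k
  by_cases hk : k ∈ s <;> simp [hk]

lemma exists_uniform_sum_rpow_le [∀ k, CompleteSpace (X k)] [CompleteSpace Y] {q : ℝ} (hq : 0 < q)
    (P : ℕ → ∀ k, X k →L[𝕂] X k)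
    (hP : ∀ (T : ContinuousMultilinearMap 𝕂 X Y) (w : ∀ k, X k),
      Summable fun j => ‖T fun k => P j k (w k)‖ ^ q) :
    ∃ K : ℝ, 0 ≤ K ∧ ∀ (τ : ℝ), 0 < τ → ∀ T : ContinuousMultilinearMap 𝕂 X Y, ‖T‖ ≤ τ →
      ∀ w : ∀ k, X k, (∀ k, ‖w k‖ ≤ 1) → ∀ F : Finset ℕ,
        ∑ j ∈ F, ‖T fun k => P j k (w k)‖ ^ q ≤ K * τ ^ q := by
  let A : ℕ → Set (ContinuousMultilinearMap 𝕂 X Y × ∀ k, X k) := fun N =>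
    {z | ∀ F : Finset ℕ, ∑ j ∈ F, ‖z.1 fun k => P j k (z.2 k)‖ ^ q ≤ N}
  have hclosed : ∀ N, IsClosed (A N) := by
    intro N
    simp only [A, Set.ofPred_forall]
    refine isClosed_iInter fun F => isClosed_le ?_ continuous_const
    refine continuous_finsetSum _ fun j _ => Continuous.rpow_const (Continuous.norm ?_)
      fun _ => Or.inr hq.le
    fun_prop
  have hunion : ⋃ N, A N = Set.univ := by
    refine Set.eq_univ_of_forall fun z => Set.mem_iUnion.2 ?_
    obtain ⟨N, hN⟩ := exists_nat_ge (∑' j, ‖z.1 fun k => P j k (z.2 k)‖ ^ q)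
    exact ⟨N, fun F => ((hP z.1 z.2).sum_le_tsum F fun _ _ => by positivity).trans hN⟩
  obtain ⟨N, ⟨T₀, v⟩, hz⟩ := nonempty_interior_of_iUnion_of_closed hclosed hunion
  obtain ⟨ε, hε, hball⟩ := Metric.isOpen_iff.1 isOpen_interior _ hz
  set δ := ε / 2 with hδ
  have hδ0 : 0 < δ := by positivity
  have h0 : ∀ T : ContinuousMultilinearMap 𝕂 X Y, ‖T‖ ≤ δ → ∀ w : ∀ k, X k, (∀ k, ‖w k‖ ≤ δ) →
      ∀ F : Finset ℕ, ∑ j ∈ F, ‖(T₀ + T) fun k => P j k ((v + w) k)‖ ^ q ≤ N := by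
    intro T hT w hw
    have : (T₀ + T, v + w) ∈ A N := by
      refine interior_subset (hball ?_)
      rw [Metric.mem_ball, dist_eq_norm]
      have : ‖(T, w)‖ ≤ δ :=
        max_le hT ((pi_norm_le_iff_of_nonneg hδ0.le).2 hw)
      simp only [Prod.mk_sub_mk, add_sub_cancel_left]
      linarith
    exact this
  have h1 : ∀ T : ContinuousMultilinearMap 𝕂 X Y, ‖T‖ ≤ δ → ∀ w : ∀ k, X k, (∀ k, ‖w k‖ ≤ δ) →
      ∀ F : Finset ℕ, ∑ j ∈ F, ‖T fun k => P j k ((v + w) k)‖ ^ q ≤ 2 ^ q * (N + N) := by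
    intro T hT w hw F
    calc _ ≤ ∑ j ∈ F, 2 ^ q * (‖(T₀ + T) fun k => P j k ((v + w) k)‖ ^ q +
          ‖(T₀ + 0) fun k => P j k ((v + w) k)‖ ^ q) := by
          refine Finset.sum_le_sum fun j _ => ?_
          have := norm_sum_rpow_le hq Finset.univ ![(T₀ + T) fun k => P j k ((v + w) k),
            -(T₀ + 0) fun k => P j k ((v + w) k)]
          simpa [Fin.sum_univ_two] using this
      _ ≤ _ := by
          rw [← Finset.mul_sum, Finset.sum_add_distrib]
          gcongr
          · exact h0 T hT w hw F
          · exact h0 0 (by simpa using hδ0.le) w hw F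
  set K₀ : ℝ := ((2 : ℝ) ^ m) ^ q * (2 ^ m * (2 ^ q * (N + N))) with hK₀
  have h2 : ∀ T : ContinuousMultilinearMap 𝕂 X Y, ‖T‖ ≤ δ → ∀ w : ∀ k, X k, (∀ k, ‖w k‖ ≤ δ) →
      ∀ F : Finset ℕ, ∑ j ∈ F, ‖T fun k => P j k (w k)‖ ^ q ≤ K₀ := by
    intro T hT w hw F
    calc _ ≤ ∑ j ∈ F, ((2 : ℝ) ^ m) ^ q * ∑ s : Finset (Fin m),
          ‖T fun k => P j k ((v + s.piecewise w 0) k)‖ ^ q :=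
          Finset.sum_le_sum fun j _ =>
            norm_map_rpow_le_sum_piecewise hq (T.compContinuousLinearMap (P j)) v w
      _ = ((2 : ℝ) ^ m) ^ q * ∑ s : Finset (Fin m),
          ∑ j ∈ F, ‖T fun k => P j k ((v + s.piecewise w 0) k)‖ ^ q := by
          rw [← Finset.mul_sum, Finset.sum_comm]
      _ ≤ ((2 : ℝ) ^ m) ^ q * ∑ s : Finset (Fin m), 2 ^ q * (N + N : ℝ) := by
          gcongr with s
          refine h1 T hT _ (fun k => ?_) F
          by_cases hk : k ∈ s <;> simp [hk, hw k, hδ0.le]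
      _ = K₀ := by simp [hK₀]
  refine ⟨K₀ / (δ * δ ^ m) ^ q, by positivity, fun τ hτ T hT w hw F => ?_⟩
  have h3 := h2 (((δ / τ : ℝ) : 𝕂) • T) (by
    rw [norm_smul, RCLike.norm_ofReal, abs_of_pos (by positivity), div_mul_eq_mul_div,
      div_le_iff₀ hτ]
    gcongr) (fun k => ((δ : ℝ) : 𝕂) • w k) (fun k => by
    rw [norm_smul, RCLike.norm_ofReal, abs_of_pos hδ0]
    exact mul_le_of_le_one_right hδ0.le (hw k)) F
  have h4 : ∀ j, ‖(((δ / τ : ℝ) : 𝕂) • T) fun k => P j k (((δ : ℝ) : 𝕂) • w k)‖ ^ q =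
      (δ * δ ^ m / τ) ^ q * ‖T fun k => P j k (w k)‖ ^ q := by
    intro j
    rw [← Real.mul_rpow (by positivity) (norm_nonneg _)]
    congr 1
    simp only [map_smul, smul_apply]
    rw [T.map_smul_univ, norm_smul, norm_smul, norm_prod]
    simp only [RCLike.norm_ofReal, Finset.prod_const, Finset.card_univ, Fintype.card_fin]
    rw [abs_of_pos hδ0, abs_of_pos (by positivity)]
    ring
  simp only [h4, ← Finset.mul_sum] at h3
  rw [Real.div_rpow (by positivity) hτ.le, div_mul_eq_mul_div, div_le_iff₀ (by positivity)] at h3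
  rw [div_mul_eq_mul_div, le_div_iff₀ (by positivity)]
  linarith

end UniformBound

lemma le_rpow_of_self_improving {β : Type*} [Nonempty β] {φ : β → ℝ}
    (hφ : BddAbove (Set.range φ)) {D θ : ℝ} (hD : 0 ≤ D) (hθ : θ < 1)
    (h : ∀ Λ, 0 < Λ → (∀ w, φ w ≤ Λ) → ∀ w, φ w ≤ D * Λ ^ θ) (w : β) :
    φ w ≤ D ^ (1 - θ)⁻¹ := by
  have hle : ∀ w, φ w ≤ ⨆ w, φ w := le_ciSup hφ
  rcases le_or_gt (⨆ w, φ w) 0 with h0 | h0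
  · exact ((hle w).trans h0).trans (by positivity)
  · refine (hle w).trans ?_
    have h1 : ⨆ w, φ w ≤ D * (⨆ w, φ w) ^ θ := ciSup_le (h _ h0 hle)
    have h2 : (⨆ w, φ w) ^ (1 - θ) ≤ D := by
      rw [Real.rpow_sub h0, Real.rpow_one]
      exact (div_le_iff₀ (by positivity)).2 h1
    exact (Real.le_rpow_inv_iff_of_pos h0.le hD (by linarith)).2 h2

section Diagonal

variable {𝕂 : Type*} [RCLike 𝕂] {m : ℕ} {X : Fin m → Type*} [∀ k, NormedAddCommGroup (X k)]
  [∀ k, NormedSpace 𝕂 (X k)] {Y : Type*} [NormedAddCommGroup Y] [NormedSpace 𝕂 Y]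

lemma opNorm_le_of_unit_ball_pi {L : ContinuousMultilinearMap 𝕂 X Y} {τ : ℝ} (hτ : 0 ≤ τ)
    (h : ∀ w : ∀ k, X k, (∀ k, ‖w k‖ ≤ 1) → ‖L w‖ ≤ τ) : ‖L‖ ≤ τ := by
  refine ContinuousMultilinearMap.opNorm_le_bound hτ fun v => ?_
  have hv : v = fun k => (‖v k‖ : 𝕂) • ((‖v k‖⁻¹ : ℝ) : 𝕂) • v k := by
    ext k
    rcases eq_or_ne (v k) 0 with h0 | h0
    · simp [h0]
    · rw [smul_smul, ← RCLike.ofReal_mul, mul_inv_cancel₀ (norm_ne_zero_iff.2 h0)]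
      simp
  have h1 := h (fun k => ((‖v k‖⁻¹ : ℝ) : 𝕂) • v k) fun k => by
    rw [norm_smul, RCLike.norm_ofReal, abs_of_nonneg (by positivity)]
    exact inv_mul_le_one
  have h2 : ‖L v‖ = (∏ k, ‖v k‖) * ‖L fun k => ((‖v k‖⁻¹ : ℝ) : 𝕂) • v k‖ := by
    conv_lhs => rw [hv]
    rw [L.map_smul_univ, norm_smul, norm_prod]
    simp
  rw [h2, mul_comm]
  gcongr

/-- The multilinear map `w ↦ ∑ j, (∏ k, f k j (w k)) • y j`. -/
noncomputable def diagonalMap (f : ∀ k, ℕ → X k →L[𝕂] 𝕂) {n : ℕ} (y : Fin n → Y) :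
    ContinuousMultilinearMap 𝕂 X Y :=
  ∑ j : Fin n, ((ContinuousMultilinearMap.mkPiAlgebra 𝕂 (Fin m) 𝕂).compContinuousLinearMap
    fun k => f k j).smulRight (y j)

lemma diagonalMap_apply (f : ∀ k, ℕ → X k →L[𝕂] 𝕂) {n : ℕ} (y : Fin n → Y) (w : ∀ k, X k) :
    diagonalMap f y w = ∑ j : Fin n, (∏ k, f k j (w k)) • y j := by
  simp [diagonalMap]

lemma diagonalMap_apply_single (hm : 0 < m) {f : ∀ k, ℕ → X k →L[𝕂] 𝕂} {e : ∀ k, ℕ → X k}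
    (hfe : ∀ k i j, f k j (e k i) = if j = i then 1 else 0) {n : ℕ} (y : Fin n → Y) (i : Fin n)
    (c : Fin m → 𝕂) : diagonalMap f y (fun k => c k • e k i) = (∏ k, c k) • y i := by
  rw [diagonalMap_apply, Finset.sum_eq_single i]
  · simp [hfe]
  · intro j _ hj
    rw [Finset.prod_eq_zero (Finset.mem_univ ⟨0, hm⟩), zero_smul]
    simp [hfe, Fin.val_inj, hj]
  · simp

lemma norm_diagonalMap_le {f : ∀ k, ℕ → X k →L[𝕂] 𝕂} {C₁ C r q Λ : ℝ} (hq : 0 < q) (hqr : q < r)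
    (hC₁ : 0 < C₁) (hC : 0 < C)
    (hf : ∀ (w : ∀ k, X k), (∀ k, ‖w k‖ ≤ 1) → ∀ j, ∏ k, ‖f k j (w k)‖ ≤ C₁)
    {n : ℕ} {y : Fin n → Y}
    (hy : ∀ c : Fin n → 𝕂, ‖∑ j, c j • y j‖ ≤ C * (∑ j, ‖c j‖ ^ r) ^ (1 / r)) (hΛ₀ : 0 < Λ)
    (hΛ : ∀ (w : ∀ k, X k), (∀ k, ‖w k‖ ≤ 1) → ∑ j : Fin n, (∏ k, ‖f k j (w k)‖) ^ q ≤ Λ) :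
    ‖diagonalMap f y‖ ≤ C * (C₁ ^ (r - q) * Λ) ^ (1 / r) := by
  refine opNorm_le_of_unit_ball_pi (by positivity) fun w hw => ?_
  have hr : 0 < r := hq.trans hqr
  rw [diagonalMap_apply]
  refine (hy _).trans ?_
  gcongr
  refine le_trans ?_ (mul_le_mul_of_nonneg_left (hΛ w hw) (by positivity))
  rw [Finset.mul_sum]
  refine Finset.sum_le_sum fun j _ => ?_
  rw [norm_prod]
  have h0 : 0 ≤ ∏ k, ‖f k j (w k)‖ := by positivity
  calc (∏ k, ‖f k j (w k)‖) ^ r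
      = (∏ k, ‖f k j (w k)‖) ^ (r - q) * (∏ k, ‖f k j (w k)‖) ^ q := by
        rw [← Real.rpow_add_of_nonneg h0 (by linarith) hq.le]
        congr 1
        ring
    _ ≤ _ := by
        gcongr
        exact hf w hw j

lemma exists_sum_prod_rpow_le (hm : 0 < m) {f : ∀ k, ℕ → X k →L[𝕂] 𝕂} {e : ∀ k, ℕ → X k}
    (hfe : ∀ k i j, f k j (e k i) = if j = i then 1 else 0) {C₁ C r q K : ℝ} (hq : 0 < q)
    (hqr : q < r) (hC₁ : 0 < C₁) (hC : 0 < C) (hK : 0 ≤ K)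
    (hf : ∀ (w : ∀ k, X k), (∀ k, ‖w k‖ ≤ 1) → ∀ j, ∏ k, ‖f k j (w k)‖ ≤ C₁)
    (hT : ∀ (τ : ℝ), 0 < τ → ∀ T : ContinuousMultilinearMap 𝕂 X Y, ‖T‖ ≤ τ →
      ∀ w : ∀ k, X k, (∀ k, ‖w k‖ ≤ 1) → ∀ F : Finset ℕ,
        ∑ j ∈ F, ‖T fun k => f k j (w k) • e k j‖ ^ q ≤ K * τ ^ q)
    (hy : ∀ n, ∃ y : Fin n → Y, (∀ j, 1 ≤ ‖y j‖) ∧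
      ∀ c : Fin n → 𝕂, ‖∑ j, c j • y j‖ ≤ C * (∑ j, ‖c j‖ ^ r) ^ (1 / r)) :
    ∃ Q : ℝ, ∀ w : ∀ k, X k, (∀ k, ‖w k‖ ≤ 1) → ∀ n,
      ∑ j ∈ Finset.range n, (∏ k, ‖f k j (w k)‖) ^ q ≤ Q := by
  have hr : 0 < r := hq.trans hqr
  refine ⟨(K * (C * (C₁ ^ (r - q)) ^ (1 / r)) ^ q) ^ (1 - q / r)⁻¹, fun w hw n => ?_⟩
  rw [Finset.sum_range]
  obtain ⟨y, hy1, hyc⟩ := hy n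
  let φ : {w : ∀ k, X k // ∀ k, ‖w k‖ ≤ 1} → ℝ := fun w =>
    ∑ j : Fin n, (∏ k, ‖f k j (w.1 k)‖) ^ q
  have : Nonempty {w : ∀ k, X k // ∀ k, ‖w k‖ ≤ 1} := ⟨⟨w, hw⟩⟩
  refine le_rpow_of_self_improving (φ := φ) ?_ (by positivity) ((div_lt_one hr).2 hqr) ?_ ⟨w, hw⟩
  · refine ⟨∑ j : Fin n, C₁ ^ q, ?_⟩
    rintro _ ⟨w, rfl⟩
    refine Finset.sum_le_sum fun j _ => ?_
    gcongr
    exact hf w.1 w.2 j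
  · intro Λ hΛ₀ hΛ w
    have hnorm := norm_diagonalMap_le hq hqr hC₁ hC hf hyc hΛ₀ fun w hw => hΛ ⟨w, hw⟩
    have h1 := hT _ (by positivity) _ hnorm w.1 w.2 (Finset.range n)
    rw [Finset.sum_range] at h1
    calc φ w ≤ ∑ j : Fin n, ‖diagonalMap f y fun k => f k j (w.1 k) • e k j‖ ^ q := by
          refine Finset.sum_le_sum fun j _ => ?_
          rw [diagonalMap_apply_single hm hfe, norm_smul, norm_prod]
          gcongr
          exact le_mul_of_one_le_right (by positivity) (hy1 j)
      _ ≤ _ := h1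
      _ = _ := by
          rw [Real.mul_rpow (x := C₁ ^ (r - q)) (by positivity) hΛ₀.le, ← mul_assoc C,
            Real.mul_rpow (y := Λ ^ (1 / r)) (by positivity) (by positivity), ← Real.rpow_mul hΛ₀.le,
            one_div_mul_eq_div, mul_assoc]

end Diagonal

/-- Multilinear case. -/
theorem stmt17 (𝕂 : Type*) [RCLike 𝕂] (m : ℕ) (hm : 0 < m)
    (X : Fin m → Type*) [∀ k, NormedAddCommGroup (X k)]
    [∀ k, NormedSpace 𝕂 (X k)] [∀ k, CompleteSpace (X k)]
    (hX : ∀ k, ¬FiniteDimensional 𝕂 (X k))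
    (e : ∀ k, ℕ → X k) (he : ∀ k, IsNormalizedUncondBasis 𝕂 (X k) (e k))
    (q : ℝ) (hq : 0 < q)
    (Y : Type*) [NormedAddCommGroup Y] [NormedSpace 𝕂 Y] [CompleteSpace Y]
    (hsum : ∀ T : ContinuousMultilinearMap 𝕂 X Y,
      ∀ x : ∀ k, ℕ → X k, (∀ k, WeaklySummable 𝕂 (x k)) →
        Summable fun j => ‖T fun k => x k j‖ ^ q)
    (hY : (q < 1 ∧ Nontrivial Y ∧ FiniteDimensional 𝕂 Y) ∨
      (¬FiniteDimensional 𝕂 Y ∧ ∃ s : ℝ, 2 ≤ s ∧ q < s ∧ ¬HasCotype Y s))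
    (t : ℝ) (ht : q < t) (x : ∀ k, X k) (a : ∀ _ : Fin m, ℕ → 𝕂)
    (ha : ∀ k, HasSum (fun j => a k j • e k j) (x k)) :
    Summable fun j => (∏ k, ‖a k j‖) ^ t := by
  choose f M hf hfu hfM using fun k => (he k).exists_coord
  have hfe : ∀ k i j, f k j (e k i) = if j = i then 1 else 0 := fun k i j =>
    hfu k (e k i) (fun j => if j = i then 1 else 0) (by
      convert hasSum_ite_eq i (e k i) using 2 with n
      by_cases h : n = i <;> simp [h]) j
  obtain ⟨K, hK, hT⟩ := exists_uniform_sum_rpow_le (Y := Y) hq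
    (fun j k => (f k j).smulRight (e k j)) fun T w =>
      hsum T (fun k j => f k j (w k) • e k j) fun k => weaklySummable_of_hasSum (hf k (w k))
  obtain ⟨r, C, hqr, hC, hy⟩ := exists_upper_estimate 𝕂 hq hY
  have hC₁ : ∀ (w : ∀ k, X k), (∀ k, ‖w k‖ ≤ 1) → ∀ j, ∏ k, ‖f k j (w k)‖ ≤ ∏ k, (|M k| + 1) := by
    intro w hw j
    gcongr with k
    calc _ ≤ M k * ‖w k‖ := hfM k j (w k)
      _ ≤ |M k| * 1 := by
        gcongr
        exacts [le_abs_self _, hw k]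
      _ ≤ _ := by linarith
  have hC₁0 : (0 : ℝ) < ∏ k, (|M k| + 1) := by positivity
  obtain ⟨Q, hQ⟩ := exists_sum_prod_rpow_le hm hfe hq hqr hC₁0 hC hK hC₁ hT hy
  let c : Fin m → ℝ := fun k => (1 + ‖x k‖)⁻¹
  have hc : ∀ k, 0 < c k := fun k => by positivity
  let w : ∀ k, X k := fun k => (c k : 𝕂) • x k
  have hw : ∀ k, ‖w k‖ ≤ 1 := fun k => by
    simp only [w, norm_smul, RCLike.norm_ofReal, abs_of_pos (hc k), c]
    rw [inv_mul_le_iff₀ (by positivity)]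
    linarith
  have hsq : Summable fun j => (∏ k, ‖f k j (w k)‖) ^ q :=
    summable_of_sum_range_le (fun _ => by positivity) (hQ w hw)
  have hst : Summable fun j => (∏ k, ‖f k j (w k)‖) ^ t := by
    refine Summable.of_nonneg_of_le (fun _ => by positivity) (fun j => ?_)
      (hsq.mul_left ((∏ k, (|M k| + 1)) ^ (t - q)))
    have h0 : 0 ≤ ∏ k, ‖f k j (w k)‖ := by positivity
    calc (∏ k, ‖f k j (w k)‖) ^ t
        = (∏ k, ‖f k j (w k)‖) ^ (t - q) * (∏ k, ‖f k j (w k)‖) ^ q := by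
          rw [← Real.rpow_add_of_nonneg h0 (by linarith) hq.le]
          congr 1
          ring
      _ ≤ _ := mul_le_mul_of_nonneg_right
          (Real.rpow_le_rpow h0 (hC₁ w hw j) (by linarith)) (by positivity)
  have hcp : 0 < ∏ k, c k := Finset.prod_pos fun k _ => hc k
  refine (summable_mul_left_iff (Real.rpow_pos_of_pos hcp t).ne').1 (hst.congr fun j => ?_)
  rw [← Real.mul_rpow hcp.le (by positivity), ← Finset.prod_mul_distrib]
  congr 1
  refine Finset.prod_congr rfl fun k _ => ?_
  simp only [w]
  rw [map_smul, norm_smul, RCLike.norm_ofReal, abs_of_pos (hc k), hfu k (x k) (a k) (ha k)]
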